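/- arXiv:1510.08337 — 8 statements merged into one kernel-verified Lean document; each statement's English description precedes it below -/
import Mathlib

section
/- There exist positive integers d_0 and d_1, depending only on r, k and the weight vectors w_1,…,w_k (and not on n), with the following property. For every positive integer n let V_n be the (finite) set of invariant multi-homogeneous monomials of degree at most d_0 in ℂ[x_{ij} : 1 ≤ i ≤ n, 1 ≤ j ≤ k], let P_n be the polynomial ring over ℂ with one indeterminate for each element of V_n, graded by assigning to the indeterminate corresponding to an invariant multi-homogeneous monomial of degree d the degree d, and let π_n : P_n → ℂ[x_{ij}] be the ℂ-algebra homomorphism sending each indeterminate to the corresponding monomial (so the image of π_n is R_n, and π_n : P_n → R_n is surjective). Then the ideal ker π_n of P_n is generated by its elements of graded degree at most d_1; equivalently, ker π_n is generated in degrees ≤ d_1 as a P_n-module, uniformly in n. -/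
open MvPolynomial

/-- The exponent function `e` is multi-homogeneous of degree `d`: each row has
total degree `d`. -/
def MultiHomog (n k d : ℕ) (e : Fin n × Fin k →₀ ℕ) : Prop :=
  ∀ i : Fin n, ∑ j, e (i, j) = d

/-- The exponent function `e` gives a monomial invariant under the torus action
with weights `w`. -/
def InvariantMon (r n k : ℕ) (w : Fin k → Fin r → ℤ) (e : Fin n × Fin k →₀ ℕ) : Prop :=
  ∑ i, ∑ j, (e (i, j) : ℤ) • w j = 0

/-- The invariant ring `R_n`: the `ℂ`-subalgebra of `ℂ[x_{ij}]` generated by all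
invariant multi-homogeneous monomials. -/
noncomputable def invariantRing (r n k : ℕ) (w : Fin k → Fin r → ℤ) :
    Subalgebra ℂ (MvPolynomial (Fin n × Fin k) ℂ) :=
  Algebra.adjoin ℂ {p | ∃ e : Fin n × Fin k →₀ ℕ, p = monomial e 1 ∧
    InvariantMon r n k w e ∧ ∃ d : ℕ, MultiHomog n k d e}

/-- The index set `V_n` of the presentation: exponent functions of invariant
multi-homogeneous monomials of degree at most `d₀`. -/
def IndexSet (r n k : ℕ) (w : Fin k → Fin r → ℤ) (d₀ : ℕ) : Type :=
  {e : Fin n × Fin k →₀ ℕ // InvariantMon r n k w e ∧ ∃ d ≤ d₀, MultiHomog n k d e}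

/-- The presentation map `π_n : P_n → ℂ[x_{ij}]` sending each indeterminate to the
corresponding invariant multi-homogeneous monomial. -/
noncomputable def presentationMap (r n k : ℕ) (w : Fin k → Fin r → ℤ) (d₀ : ℕ) :
    MvPolynomial (IndexSet r n k w d₀) ℂ →ₐ[ℂ] MvPolynomial (Fin n × Fin k) ℂ :=
  aeval fun v => monomial v.1 1

/-- The graded degree of an indeterminate of `P_n`: the multi-homogeneous degree of the
corresponding monomial, read off as the total degree of its first row (`n > 0`). -/
def indetDegree {r n k : ℕ} {w : Fin k → Fin r → ℤ} {d₀ : ℕ} (hn : 0 < n)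
    (v : IndexSet r n k w d₀) : ℕ :=
  ∑ j, v.1 (⟨0, hn⟩, j)

theorem Multiset.exists_le_map_eq {α β : Type*} (f : α → β) {s : Multiset α} {m : Multiset β}
    (h : m ≤ s.map f) : ∃ t ≤ s, t.map f = m := by
  induction s using Quotient.inductionOn with | _ s => ?_
  induction m using Quotient.inductionOn with | _ m => ?_
  obtain ⟨l, hl, hls⟩ := (Multiset.coe_le.1 h : m.Subperm (s.map f))
  obtain ⟨l', hl', rfl⟩ := List.sublist_map_iff.1 hls
  exact ⟨l', Multiset.coe_le.2 hl'.subperm, Quotient.sound hl⟩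

/-- Zero-sum multisets of integer vectors in a box contain short nonempty zero-sum
sub-multisets. -/
theorem exists_zeroSum_bound (r R : ℕ) : ∃ N : ℕ, ∀ {α : Type} (s : Multiset α)
    (v : α → Fin r → ℤ), (∀ a ∈ s, ∀ l, |v a l| ≤ R) → s ≠ 0 → (s.map v).sum = 0 →
    ∃ t ≤ s, t ≠ 0 ∧ (t.map v).sum = 0 ∧ t.card ≤ N := by
  classical
  let β := {b : Fin r → ℤ // b ∈ Set.Icc (fun _ => -(R : ℤ)) (fun _ => (R : ℤ))}
  have : Finite β := (Set.finite_Icc _ _).to_subtype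
  have hw : WellQuasiOrderedLE (Multiset β) :=
    (Finsupp.orderIsoMultiset (ι := β)).wellQuasiOrderedLE_iff.1 inferInstance
  let S : Set (Multiset β) := {m | m ≠ 0 ∧ (m.map Subtype.val).sum = 0}
  have hfin : {m | Minimal (· ∈ S) m}.Finite :=
    WellQuasiOrderedLE.finite_of_isAntichain (setOfPred_minimal_antichain _)
  refine ⟨hfin.toFinset.sup Multiset.card, fun {α} s v hv hs h0 => ?_⟩
  have hbox : ∀ a ∈ s, v a ∈ Set.Icc (fun _ => -(R : ℤ)) (fun _ => (R : ℤ)) := fun a ha =>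
    ⟨fun l => (abs_le.1 (hv a ha l)).1, fun l => (abs_le.1 (hv a ha l)).2⟩
  let m : Multiset β := s.attach.map fun a => ⟨v a.1, hbox a.1 a.2⟩
  have hm : m ∈ S := by
    refine ⟨fun h => hs ?_, ?_⟩
    · rw [← Multiset.card_eq_zero, ← Multiset.card_attach]
      simpa [m] using congrArg Multiset.card h
    · simp only [m, Multiset.map_map, Function.comp_def]
      rw [Multiset.attach_map_val' s v, h0]
  obtain ⟨m', hle, hmin⟩ := exists_minimal_le_of_wellFoundedLT (· ∈ S) m hm
  obtain ⟨t, ht, htm⟩ := Multiset.exists_le_map_eq _ hle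
  refine ⟨t.map Subtype.val, ?_, ?_, ?_, ?_⟩
  · simpa using Multiset.map_le_map (f := Subtype.val) ht
  · have := hmin.1.1
    rw [← htm] at this
    simpa using this
  · have := hmin.1.2
    rw [← htm] at this
    simpa [Multiset.map_map, Function.comp_def] using this
  · have : m'.card ≤ hfin.toFinset.sup Multiset.card :=
      Finset.le_sup (f := Multiset.card) (hfin.mem_toFinset.2 hmin)
    simpa [← htm] using this

theorem exists_signs {ι κ : Type*} [DecidableEq ι] [DecidableEq κ] (s : Finset ι) (a b : ι → κ) :
    ∃ σ : ι → ℤ, (∀ i, σ i = 1 ∨ σ i = -1) ∧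
      ∀ j, |∑ i ∈ s, σ i * ((Pi.single (a i) 1 - Pi.single (b i) 1 : κ → ℤ) j)| ≤ 1 := by
  induction hN : s.card generalizing s a b with
  | zero =>
    obtain rfl := Finset.card_eq_zero.1 hN
    exact ⟨fun _ => 1, by simp, by simp⟩
  | succ N ih =>
    by_cases hloop : ∃ i ∈ s, a i = b i
    · obtain ⟨i, hi, hab⟩ := hloop
      obtain ⟨σ, h1, h2⟩ := ih (s.erase i) a b (by simp [hi, hN])
      refine ⟨σ, h1, fun j => ?_⟩
      rw [← Finset.add_sum_erase s _ hi]
      simpa [hab] using h2 j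
    by_cases hpair : ∃ i ∈ s, ∃ i' ∈ s, i ≠ i' ∧ ∃ η η' : ℤ, (η = 1 ∨ η = -1) ∧
        (η' = 1 ∨ η' = -1) ∧ ∃ u v : κ, η • (Pi.single (a i) 1 - Pi.single (b i) 1 : κ → ℤ) +
        η' • (Pi.single (a i') 1 - Pi.single (b i') 1 : κ → ℤ) = Pi.single u 1 - Pi.single v 1
    · obtain ⟨i, hi, i', hi', hne, η, η', hη, hη', u, v, huv⟩ := hpair
      obtain ⟨σ, h1, h2⟩ := ih (s.erase i) (Function.update a i' u) (Function.update b i' v)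
        (by simp [hi, hN])
      refine ⟨Function.update (Function.update σ i' (σ i' * η')) i (σ i' * η), fun l => ?_,
        fun j => ?_⟩
      · rcases eq_or_ne l i with rfl | hl
        · rcases h1 i' with h | h <;> rcases hη with h' | h' <;> simp [h, h']
        · rcases eq_or_ne l i' with rfl | hl'
          · rcases h1 l with h | h <;> rcases hη' with h' | h' <;> simp [h, h', hl]
          · simpa [hl, hl'] using h1 l
      · have h := h2 j
        have hi'' : i' ∈ s.erase i := by simp [hi', hne.symm]
        rw [← Finset.add_sum_erase _ _ hi''] at h
        rw [← Finset.add_sum_erase s _ hi, ← Finset.add_sum_erase _ _ hi'']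
        have huvj := congrFun huv j
        simp only [Pi.add_apply, Pi.smul_apply, smul_eq_mul] at huvj
        simp only [Function.update_self, Function.update_of_ne hne.symm] at h ⊢
        rw [← huvj] at h
        convert h using 2
        rw [← add_assoc]
        congr 1
        · ring
        · refine Finset.sum_congr rfl fun l hl => ?_
          have h3 : l ≠ i' := (Finset.mem_erase.1 hl).1
          have h4 : l ≠ i := (Finset.mem_erase.1 (Finset.mem_erase.1 hl).2).1
          simp [h3, h4]
    · refine ⟨fun _ => 1, by simp, fun j => ?_⟩
      have key : ∀ i ∈ s, ∀ i' ∈ s, i ≠ i' → (a i = j ∨ b i = j) → (a i' = j ∨ b i' = j) →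
          False := by
        intro i hi i' hi' hne h h'
        refine hpair ⟨i, hi, i', hi', hne, ?_⟩
        rcases h with h | h <;> rcases h' with h' | h'
        · exact ⟨1, -1, by simp, by simp, b i', b i, by rw [h, h']; module⟩
        · exact ⟨1, 1, by simp, by simp, a i', b i, by rw [h, h']; module⟩
        · exact ⟨1, 1, by simp, by simp, a i, b i', by rw [h, h']; module⟩
        · exact ⟨1, -1, by simp, by simp, a i, a i', by rw [h, h']; module⟩
      by_cases hex : ∃ i ∈ s, a i = j ∨ b i = j
      · obtain ⟨i, hi, hij⟩ := hex
        rw [Finset.sum_eq_single_of_mem i hi]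
        · have : a i ≠ b i := fun h => hloop ⟨i, hi, h⟩
          simp only [Pi.sub_apply, Pi.single_apply, one_mul]
          split_ifs <;> simp
        · intro i' hi' hne
          by_contra h
          refine key i hi i' hi' hne.symm hij ?_
          by_contra! h'
          exact h (by simp [h'.1.symm, h'.2.symm])
      · push Not at hex
        rw [Finset.sum_eq_zero]
        · simp
        · intro i hi
          simp [(hex i hi).1.symm, (hex i hi).2.symm]

section Columns

variable {n k : ℕ}

/-- The exponent of the degree-one multi-homogeneous monomial with letter `c i` in row `i`. -/
noncomputable def colExp (c : Fin n → Fin k) : Fin n × Fin k →₀ ℕ :=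
  ∑ i, Finsupp.single (i, c i) 1

/-- The exponent of the product of the monomials given by a multiset of columns. -/
noncomputable def content (M : Multiset (Fin n → Fin k)) : Fin n × Fin k →₀ ℕ :=
  (M.map colExp).sum

/-- The number of occurrences of a letter in a column. -/
def letterCount (c : Fin n → Fin k) (j : Fin k) : ℕ := (Finset.univ.filter fun i => c i = j).card

/-- The torus weight of a column. -/
def colWeight {r : ℕ} (w : Fin k → Fin r → ℤ) (c : Fin n → Fin k) : Fin r → ℤ := ∑ i, w (c i)

/-- Any two columns use each letter equally often, up to one. -/
def IsBalanced (M : Multiset (Fin n → Fin k)) : Prop :=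
  ∀ c ∈ M, ∀ c' ∈ M, ∀ j, letterCount c j ≤ letterCount c' j + 1

/-- Every column uses each letter `j` either `q j` or `q j + 1` times. -/
def HasLevel (q : Fin k → ℕ) (M : Multiset (Fin n → Fin k)) : Prop :=
  ∀ c ∈ M, ∀ j, q j ≤ letterCount c j ∧ letterCount c j ≤ q j + 1

/-- The sum of the squares of all letter counts. -/
def energy (M : Multiset (Fin n → Fin k)) : ℕ := (M.map fun c => ∑ j, letterCount c j ^ 2).sum

theorem colExp_apply (c : Fin n → Fin k) (i : Fin n) (j : Fin k) :
    colExp c (i, j) = if c i = j then 1 else 0 := by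
  rw [colExp, Finsupp.finsetSum_apply, Finset.sum_eq_single i]
  · simp [Finsupp.single_apply]
  · intro b _ hb
    simp [hb]
  · simp

@[simp] theorem content_zero : content (0 : Multiset (Fin n → Fin k)) = 0 := rfl

@[simp] theorem content_cons (c : Fin n → Fin k) (M) :
    content (c ::ₘ M) = colExp c + content M := by simp [content]

@[simp] theorem content_add (M N : Multiset (Fin n → Fin k)) :
    content (M + N) = content M + content N := by simp [content]

theorem sum_content_col (M : Multiset (Fin n → Fin k)) (j : Fin k) :
    ∑ i, content M (i, j) = (M.map (letterCount · j)).sum := by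
  induction M using Multiset.induction with
  | empty => simp
  | cons c M ih =>
    simp [Finset.sum_add_distrib, ih, colExp_apply, letterCount]

theorem sum_content_row (M : Multiset (Fin n → Fin k)) (i : Fin n) :
    ∑ j, content M (i, j) = M.card := by
  induction M using Multiset.induction with
  | empty => simp
  | cons c M ih => simp [Finset.sum_add_distrib, ih, colExp_apply, add_comm]

theorem multiHomog_content (M : Multiset (Fin n → Fin k)) : MultiHomog n k M.card (content M) :=
  sum_content_row M

theorem card_eq_of_content_eq (hn : 0 < n) {M N : Multiset (Fin n → Fin k)}
    (h : content M = content N) : M.card = N.card := by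
  rw [← sum_content_row M ⟨0, hn⟩, h, sum_content_row]

theorem sum_letterCount_eq_of_content_eq {M N : Multiset (Fin n → Fin k)}
    (h : content M = content N) (j : Fin k) :
    (M.map (letterCount · j)).sum = (N.map (letterCount · j)).sum := by
  rw [← sum_content_col, h, sum_content_col]

theorem sum_colWeight {r : ℕ} (w : Fin k → Fin r → ℤ) (M : Multiset (Fin n → Fin k)) :
    (M.map (colWeight w)).sum = ∑ i, ∑ j, (content M (i, j) : ℤ) • w j := by
  induction M using Multiset.induction with
  | empty => simp
  | cons c M ih =>
    simp [Finset.sum_add_distrib, ih, colExp_apply, colWeight, add_smul]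

theorem invariantMon_content {r : ℕ} (w : Fin k → Fin r → ℤ) (M : Multiset (Fin n → Fin k)) :
    InvariantMon r n k w (content M) ↔ (M.map (colWeight w)).sum = 0 := by
  rw [sum_colWeight, InvariantMon]

theorem sum_colWeight_eq_of_content_eq {r : ℕ} (w : Fin k → Fin r → ℤ)
    {M N : Multiset (Fin n → Fin k)} (h : content M = content N) :
    (M.map (colWeight w)).sum = (N.map (colWeight w)).sum := by
  rw [sum_colWeight, h, sum_colWeight]

theorem exists_mem_of_content_pos {M : Multiset (Fin n → Fin k)} {i : Fin n} {j : Fin k}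
    (h : 0 < content M (i, j)) : ∃ c ∈ M, c i = j := by
  induction M using Multiset.induction with
  | empty => simp at h
  | cons c M ih =>
    by_cases hc : c i = j
    · exact ⟨c, by simp, hc⟩
    · obtain ⟨c', h1, h2⟩ := ih (by simpa [colExp_apply, hc] using h)
      exact ⟨c', by simp [h1], h2⟩

theorem content_pos_of_mem {M : Multiset (Fin n → Fin k)} {c : Fin n → Fin k} (h : c ∈ M)
    (i : Fin n) : 0 < content M (i, c i) := by
  obtain ⟨N, rfl⟩ := Multiset.exists_cons_of_mem h
  simp [colExp_apply]

theorem colExp_le {c : Fin n → Fin k} {e : Fin n × Fin k →₀ ℕ} (h : ∀ i, 0 < e (i, c i)) :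
    colExp c ≤ e := by
  rintro ⟨i, j⟩
  rw [colExp_apply]
  split_ifs with hc
  · exact hc ▸ h i
  · exact Nat.zero_le _

theorem exists_content_eq {d : ℕ} {e : Fin n × Fin k →₀ ℕ} (h : MultiHomog n k d e) :
    ∃ M : Multiset (Fin n → Fin k), M.card = d ∧ content M = e := by
  induction d generalizing e with
  | zero =>
    refine ⟨0, rfl, ?_⟩
    ext ⟨i, j⟩
    have := Finset.sum_eq_zero_iff.1 (h i) j (Finset.mem_univ j)
    simp [this]
  | succ d ih =>
    have hex : ∀ i, ∃ j, 0 < e (i, j) := by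
      intro i
      by_contra! hc
      have := h i
      rw [Finset.sum_eq_zero fun j _ => Nat.le_zero.1 (hc j)] at this
      omega
    choose c hc using hex
    have hle := colExp_le hc
    obtain ⟨M, hM, hMe⟩ := ih (e := e - colExp c) (by
      intro i
      have h1 := h i
      rw [← tsub_add_cancel_of_le hle] at h1
      simp only [Finsupp.add_apply, Finset.sum_add_distrib, colExp_apply, Finset.sum_ite_eq,
        Finset.mem_univ, if_true] at h1
      omega)
    exact ⟨c ::ₘ M, by simp [hM], by simp [hMe, add_tsub_cancel_of_le hle]⟩

theorem colWeight_eq_sum_letterCount {r : ℕ} (w : Fin k → Fin r → ℤ) (c : Fin n → Fin k)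
    (l : Fin r) : colWeight w c l = ∑ j, (letterCount c j : ℤ) * w j l := by
  simp only [colWeight, letterCount, Finset.sum_apply, Finset.card_filter, Nat.cast_sum,
    Finset.sum_mul]
  rw [Finset.sum_comm]
  simp

theorem IsBalanced.abs_colWeight_le {r : ℕ} {w : Fin k → Fin r → ℤ}
    {M : Multiset (Fin n → Fin k)} (hM : IsBalanced M) (h0 : (M.map (colWeight w)).sum = 0)
    {c : Fin n → Fin k} (hc : c ∈ M) (l : Fin r) : |colWeight w c l| ≤ ∑ j, |w j l| := by
  have hdiff : ∀ c' ∈ M, |colWeight w c l - colWeight w c' l| ≤ ∑ j, |w j l| := by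
    intro c' hc'
    rw [colWeight_eq_sum_letterCount, colWeight_eq_sum_letterCount, ← Finset.sum_sub_distrib]
    refine (Finset.abs_sum_le_sum_abs _ _).trans (Finset.sum_le_sum fun j _ => ?_)
    rw [← sub_mul, abs_mul]
    refine mul_le_of_le_one_left (abs_nonneg _) (abs_le.2 ?_)
    have h1 := hM c hc c' hc' j
    have h2 := hM c' hc' c hc j
    omega
  have hsum : (M.map fun c' => colWeight w c l - colWeight w c' l).sum =
      M.card * colWeight w c l := by
    have h1 : (M.map fun c' => colWeight w c' l).sum = 0 := by
      have := congrArg (Pi.evalAddMonoidHom (fun _ : Fin r => ℤ) l) h0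
      rw [map_multiset_sum, Multiset.map_map] at this
      simpa [Function.comp_def] using this
    rw [Multiset.sum_map_sub, h1]
    simp
  have hle : (M.card : ℤ) * |colWeight w c l| ≤ M.card * ∑ j, |w j l| := by
    rw [← Nat.abs_cast M.card, ← abs_mul, ← hsum, Nat.abs_cast]
    refine (Multiset.abs_sum_le_sum_abs).trans ?_
    rw [Multiset.map_map]
    have := Multiset.sum_le_card_nsmul (M.map fun c' => |colWeight w c l - colWeight w c' l|)
      (∑ j, |w j l|) (by simpa using hdiff)
    simpa [Function.comp_def] using this
  have hpos : (0 : ℤ) < M.card := by exact_mod_cast Multiset.card_pos_iff_exists_mem.2 ⟨c, hc⟩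
  exact le_of_mul_le_mul_left hle hpos

theorem HasLevel.isBalanced {q : Fin k → ℕ} {M : Multiset (Fin n → Fin k)} (h : HasLevel q M) :
    IsBalanced M := fun c hc c' hc' j => by
  have := h c hc j
  have := h c' hc' j
  omega

theorem IsBalanced.hasLevel {q : Fin k → ℕ} {M : Multiset (Fin n → Fin k)} (h : IsBalanced M)
    (h1 : ∀ j, M.card * q j ≤ (M.map (letterCount · j)).sum)
    (h2 : ∀ j, (M.map (letterCount · j)).sum ≤ M.card * (q j + 1)) : HasLevel q M := by
  intro c hc j
  obtain ⟨N, rfl⟩ := Multiset.exists_cons_of_mem hc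
  have h1 := h1 j
  have h2 := h2 j
  simp only [Multiset.map_cons, Multiset.sum_cons, Multiset.card_cons, add_mul, one_mul] at h1 h2
  constructor
  · by_contra! hlt
    have := Multiset.sum_le_card_nsmul (N.map (letterCount · j)) (q j) (by
      simp only [Multiset.mem_map, forall_exists_index, and_imp, forall_apply_eq_imp_iff₂]
      intro c' hc'
      have := h c' (by simp [hc']) c hc j
      omega)
    simp only [Multiset.card_map, smul_eq_mul] at this
    omega
  · by_contra! hlt
    have := Multiset.card_nsmul_le_sum (s := N.map (letterCount · j)) (a := q j + 1) (by
      simp only [Multiset.mem_map, forall_exists_index, and_imp, forall_apply_eq_imp_iff₂]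
      intro c' hc'
      have := h c hc c' (by simp [hc']) j
      omega)
    simp only [Multiset.card_map, smul_eq_mul] at this
    omega

theorem exists_energy_lt {M : Multiset (Fin n → Fin k)} (h : ¬ IsBalanced M) :
    ∃ M', content M' = content M ∧ energy M' < energy M := by
  simp only [IsBalanced, not_forall, not_le] at h
  obtain ⟨c, hc, c', hc', j₀, hj⟩ := h
  obtain ⟨N, rfl⟩ := Multiset.exists_cons_of_mem hc
  have hne : c' ≠ c := by
    rintro rfl
    omega
  obtain ⟨N, rfl⟩ := Multiset.exists_cons_of_mem ((Multiset.mem_cons.1 hc').resolve_left hne)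
  obtain ⟨σ, hσ, hbal⟩ := exists_signs (Finset.univ : Finset (Fin n)) c c'
  let a : Fin n → Fin k := fun i => if σ i = 1 then c i else c' i
  let b : Fin n → Fin k := fun i => if σ i = 1 then c' i else c i
  have hcont : colExp a + colExp b = colExp c + colExp c' := by
    ext ⟨i, j⟩
    simp only [Finsupp.add_apply, colExp_apply, a, b]
    split_ifs <;> simp_all
  have hadd : ∀ j, letterCount a j + letterCount b j = letterCount c j + letterCount c' j := by
    intro j
    have := sum_letterCount_eq_of_content_eq (M := {a, b}) (N := {c, c'})
      (by simpa [content] using hcont) j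
    simpa using this
  have hab : ∀ j, |(letterCount a j : ℤ) - letterCount b j| ≤ 1 := by
    intro j
    convert hbal j using 2
    simp only [letterCount, Finset.card_filter, Nat.cast_sum, ← Finset.sum_sub_distrib]
    refine Finset.sum_congr rfl fun i _ => ?_
    rcases hσ i with h | h <;>
      simp [a, b, h, Pi.single_apply, eq_comm (a := j)]
  refine ⟨a ::ₘ b ::ₘ N, by simp [← add_assoc, hcont], ?_⟩
  simp only [energy, Multiset.map_cons, Multiset.sum_cons, ← add_assoc, ← Finset.sum_add_distrib]
  refine Nat.add_lt_add_right (Finset.sum_lt_sum (fun j _ => ?_) ⟨j₀, Finset.mem_univ _, ?_⟩) _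
  · have h1 := hadd j
    have h2 := abs_le.1 (hab j)
    zify at h1 ⊢
    rcases (by omega : (letterCount a j : ℤ) - letterCount b j = -1 ∨
      (letterCount a j : ℤ) - letterCount b j = 0 ∨
      (letterCount a j : ℤ) - letterCount b j = 1) with h | h | h
    · have : (letterCount c j : ℤ) - letterCount c' j ≤ -1 ∨
        1 ≤ (letterCount c j : ℤ) - letterCount c' j := by omega
      rcases this with h' | h' <;> nlinarith
    · nlinarith [sq_nonneg ((letterCount c j : ℤ) - letterCount c' j)]
    · have : (letterCount c j : ℤ) - letterCount c' j ≤ -1 ∨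
        1 ≤ (letterCount c j : ℤ) - letterCount c' j := by omega
      rcases this with h' | h' <;> nlinarith
  · have h1 := hadd j₀
    have h2 := abs_le.1 (hab j₀)
    zify at h1 hj ⊢
    nlinarith

theorem exists_isBalanced (M : Multiset (Fin n → Fin k)) :
    ∃ M', content M' = content M ∧ IsBalanced M' ∧ energy M' ≤ energy M ∧
      (¬ IsBalanced M → energy M' < energy M) := by
  induction hE : energy M using Nat.strong_induction_on generalizing M with
  | _ E ih =>
    by_cases h : IsBalanced M
    · exact ⟨M, rfl, h, hE.le, fun h' => absurd h h'⟩
    · obtain ⟨M₁, hc, hlt⟩ := exists_energy_lt h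
      obtain ⟨M₂, hc₂, hb, he, -⟩ := ih _ (hE ▸ hlt) M₁ rfl
      have := he.trans_lt hlt
      exact ⟨M₂, hc₂.trans hc, hb, by omega, fun _ => by omega⟩

end Columns

section Moves

variable {n k : ℕ}

theorem cast_letterCount_piecewise_sub (c c' : Fin n → Fin k) (D : Finset (Fin n)) (j : Fin k) :
    (letterCount (D.piecewise c' c) j : ℤ) - letterCount c j =
      ∑ i ∈ D, ((Pi.single (c' i) 1 - Pi.single (c i) 1 : Fin k → ℤ) j) := by
  simp only [letterCount, Finset.card_filter, Nat.cast_sum, ← Finset.sum_sub_distrib]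
  rw [← Finset.sum_subset (Finset.subset_univ D)]
  · refine Finset.sum_congr rfl fun i hi => ?_
    simp [Finset.piecewise_eq_of_mem _ _ _ hi, Pi.single_apply, eq_comm (a := j)]
  · intro i _ hi
    simp [Finset.piecewise_eq_of_notMem _ _ _ hi]

/-- Two columns with letter counts differing by at most one can be transformed into each other
by exchanging a bounded number of rows at a time, with each letter count always equal to one of
the two original ones. -/
theorem exists_row_exchange (k : ℕ) : ∃ N : ℕ, ∀ {n : ℕ} (c c' : Fin n → Fin k),
    (∀ j, |(letterCount c j : ℤ) - letterCount c' j| ≤ 1) → c ≠ c' →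
    ∃ D : Finset (Fin n), D.Nonempty ∧ (∀ i ∈ D, c i ≠ c' i) ∧ D.card ≤ N ∧
      ∀ j, letterCount (D.piecewise c' c) j = letterCount c j ∨
        letterCount (D.piecewise c' c) j = letterCount c' j := by
  obtain ⟨N, hN⟩ := exists_zeroSum_bound k 1
  refine ⟨N, fun {n} c c' hcc hne => ?_⟩
  let rows : Finset (Fin n) := Finset.univ.filter fun i => c i ≠ c' i
  let letters : Finset (Fin k) := Finset.univ.filter fun j => letterCount c j ≠ letterCount c' j
  let v : Fin n ⊕ Fin k → Fin k → ℤ := Sum.elim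
    (fun i => Pi.single (c' i) 1 - Pi.single (c i) 1)
    (fun j => Pi.single j ((letterCount c j : ℤ) - letterCount c' j))
  have hsum : ∀ (D : Finset (Fin n)) (E : Finset (Fin k)) (j : Fin k),
      (∑ a ∈ D.disjSum E, v a) j = (letterCount (D.piecewise c' c) j : ℤ) - letterCount c j +
        if j ∈ E then (letterCount c j : ℤ) - letterCount c' j else 0 := by
    intro D E j
    rw [cast_letterCount_piecewise_sub, Finset.sum_disjSum, Pi.add_apply, Finset.sum_apply,
      Finset.sum_apply]
    congr 1
    simp [v, Pi.single_apply]
  have hrows : rows.piecewise c' c = c' := by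
    ext1 i
    by_cases hi : c i = c' i <;> simp [rows, Finset.piecewise, hi]
  obtain ⟨t, hle, ht0, htsum, hcard⟩ := hN (rows.disjSum letters).val v (by
      rintro (i | j) ha l
      · simp only [v, Sum.elim_inl, Pi.sub_apply, Pi.single_apply]
        split_ifs <;> simp
      · simp only [v, Sum.elim_inr, Pi.single_apply]
        split_ifs
        · simpa using hcc j
        · simp)
    (by
      obtain ⟨i, hi⟩ := Function.ne_iff.1 hne
      intro h
      have : Sum.inl i ∈ rows.disjSum letters := by simp [rows, hi]
      rw [← Finset.mem_val, h] at this
      simp at this)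
    (by
      ext j
      refine (hsum rows letters j).trans ?_
      rw [hrows]
      by_cases hj : letterCount c j = letterCount c' j <;> simp [letters, hj])
  let T : Finset (Fin n ⊕ Fin k) := ⟨t, Multiset.nodup_of_le hle (Finset.nodup _)⟩
  have hT : T ⊆ rows.disjSum letters := Finset.val_le_iff.1 hle
  have hL : ∀ i ∈ T.toLeft, c i ≠ c' i := fun i hi => by
    simpa [rows] using hT (Finset.mem_toLeft.1 hi)
  have hR : ∀ j ∈ T.toRight, letterCount c j ≠ letterCount c' j := fun j hj => by
    simpa [letters] using hT (Finset.mem_toRight.1 hj)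
  have hzero : ∀ j, (letterCount (T.toLeft.piecewise c' c) j : ℤ) - letterCount c j +
      (if j ∈ T.toRight then (letterCount c j : ℤ) - letterCount c' j else 0) = 0 := by
    intro j
    rw [← hsum, Finset.toLeft_disjSum_toRight]
    exact congrFun htsum j
  refine ⟨T.toLeft, ?_, hL, ?_, fun j => ?_⟩
  · by_contra hemp
    rw [Finset.not_nonempty_iff_eq_empty] at hemp
    obtain ⟨a, ha⟩ := Multiset.exists_mem_of_ne_zero ht0
    have ha : a ∈ T := ha
    rcases a with i | j
    · have := Finset.mem_toLeft.2 ha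
      simp [hemp] at this
    · have hj := Finset.mem_toRight.2 ha
      have := hzero j
      rw [cast_letterCount_piecewise_sub, hemp, Finset.sum_empty, zero_add, if_pos hj] at this
      exact hR j hj (by omega)
  · exact Finset.card_toLeft_le.trans hcard
  · have := hzero j
    split_ifs at this <;> omega

theorem HasLevel.cons {q : Fin k → ℕ} {M : Multiset (Fin n → Fin k)} {c : Fin n → Fin k}
    (hc : ∀ j, q j ≤ letterCount c j ∧ letterCount c j ≤ q j + 1) (h : HasLevel q M) :
    HasLevel q (c ::ₘ M) := by
  intro c' hc'
  rcases Multiset.mem_cons.1 hc' with rfl | h'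
  · exact hc
  · exact h c' h'

theorem HasLevel.of_le {q : Fin k → ℕ} {M N : Multiset (Fin n → Fin k)} (h : HasLevel q M)
    (hle : N ≤ M) : HasLevel q N := fun c hc => h c (Multiset.mem_of_le hle hc)

theorem HasLevel.add {q : Fin k → ℕ} {M N : Multiset (Fin n → Fin k)} (hM : HasLevel q M)
    (hN : HasLevel q N) : HasLevel q (M + N) := fun c hc =>
  (Multiset.mem_add.1 hc).elim (hM c) (hN c)

theorem HasLevel.card_mul_le {q : Fin k → ℕ} {M : Multiset (Fin n → Fin k)} (h : HasLevel q M)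
    (j : Fin k) : M.card * q j ≤ (M.map (letterCount · j)).sum := by
  have := Multiset.card_nsmul_le_sum (s := M.map (letterCount · j)) (a := q j) (by
    simp only [Multiset.mem_map, forall_exists_index, and_imp, forall_apply_eq_imp_iff₂]
    exact fun c hc => (h c hc j).1)
  simpa using this

theorem HasLevel.le_card_mul {q : Fin k → ℕ} {M : Multiset (Fin n → Fin k)} (h : HasLevel q M)
    (j : Fin k) : (M.map (letterCount · j)).sum ≤ M.card * (q j + 1) := by
  have := Multiset.sum_le_card_nsmul (M.map (letterCount · j)) (q j + 1) (by
    simp only [Multiset.mem_map, forall_exists_index, and_imp, forall_apply_eq_imp_iff₂]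
    exact fun c hc => (h c hc j).2)
  simpa using this

theorem HasLevel.exists_letterCount_eq {q : Fin k → ℕ} {M M' : Multiset (Fin n → Fin k)}
    (hM : HasLevel q M) (hM' : HasLevel q M') (hn : 0 < n) (h : content M = content M')
    {c' : Fin n → Fin k} (hc' : c' ∈ M') (j : Fin k) :
    ∃ s ∈ M, letterCount s j = letterCount c' j := by
  by_contra! hne
  obtain ⟨N, rfl⟩ := Multiset.exists_cons_of_mem hc'
  have hcard := card_eq_of_content_eq hn h
  have hsum := sum_letterCount_eq_of_content_eq h j
  have hN : HasLevel q N := hM'.of_le (Multiset.le_cons_self N c')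
  have h1 := hN.card_mul_le j
  have h2 := hN.le_card_mul j
  rw [Multiset.map_cons, Multiset.sum_cons] at hsum
  rw [Multiset.card_cons] at hcard
  have hc := hM' c' hc' j
  rcases (by omega : letterCount c' j = q j ∨ letterCount c' j = q j + 1) with hq | hq
  · have : M.map (letterCount · j) = M.map fun _ => q j + 1 :=
      Multiset.map_congr rfl fun s hs => by
        have := hne s hs
        have := hM s hs j
        omega
    rw [this, Multiset.map_const', Multiset.sum_replicate, hcard, smul_eq_mul, add_mul] at hsum
    omega
  · have : M.map (letterCount · j) = M.map fun _ => q j :=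
      Multiset.map_congr rfl fun s hs => by
        have := hne s hs
        have := hM s hs j
        omega
    rw [this, Multiset.map_const', Multiset.sum_replicate, hcard, smul_eq_mul, add_mul] at hsum
    omega

/-- Replacement of at most `C` columns by columns with the same content, within a level. -/
def ColMove (C : ℕ) (q : Fin k → ℕ) (M M' : Multiset (Fin n → Fin k)) : Prop :=
  HasLevel q M ∧ HasLevel q M' ∧ ∃ N K K', M = K + N ∧ M' = K' + N ∧
    content K = content K' ∧ K.card ≤ C

theorem ColMove.content_eq {C : ℕ} {q : Fin k → ℕ} {M M' : Multiset (Fin n → Fin k)}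
    (h : ColMove C q M M') : content M = content M' := by
  obtain ⟨-, -, N, K, K', rfl, rfl, hK, -⟩ := h
  simp [hK]

theorem ColMove.cons {C : ℕ} {q : Fin k → ℕ} {M M' : Multiset (Fin n → Fin k)}
    (h : ColMove C q M M') {c : Fin n → Fin k}
    (hc : ∀ j, q j ≤ letterCount c j ∧ letterCount c j ≤ q j + 1) :
    ColMove C q (c ::ₘ M) (c ::ₘ M') := by
  obtain ⟨h1, h2, N, K, K', rfl, rfl, hK, hC⟩ := h
  exact ⟨h1.cons hc, h2.cons hc, c ::ₘ N, K, K', by simp, by simp, hK, hC⟩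

theorem exists_colMove_toward (k : ℕ) : ∃ C : ℕ, ∀ {n : ℕ} (_ : 0 < n) {q : Fin k → ℕ}
    {c c' : Fin n → Fin k} {M₁ M' : Multiset (Fin n → Fin k)}, HasLevel q (c ::ₘ M₁) →
    HasLevel q M' → content (c ::ₘ M₁) = content M' → c' ∈ M' → c ≠ c' →
    ∃ c₁ M₂, ColMove C q (c ::ₘ M₁) (c₁ ::ₘ M₂) ∧
      (Finset.univ.filter fun i => c₁ i ≠ c' i).card <
        (Finset.univ.filter fun i => c i ≠ c' i).card := by
  obtain ⟨D₀, hD₀⟩ := exists_row_exchange k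
  refine ⟨D₀ + k + 1, fun {n} hn {q c c' M₁ M'} hM hM' hcont hc' hne => ?_⟩
  have hcq := hM c (by simp)
  have hcq' := hM' c' hc'
  obtain ⟨D, hDne, hDdiff, hDcard, hDcount⟩ := hD₀ c c'
    (fun j => abs_le.2 (by have := hcq j; have := hcq' j; omega)) hne
  set c₁ := D.piecewise c' c with hc₁
  have hc₁q : ∀ j, q j ≤ letterCount c₁ j ∧ letterCount c₁ j ≤ q j + 1 := fun j =>
    (hDcount j).elim (fun h => h ▸ hcq j) fun h => h ▸ hcq' j
  have hrow : ∀ i, ∃ s ∈ c ::ₘ M₁, s i = c' i := fun i =>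
    exists_mem_of_content_pos (hcont ▸ content_pos_of_mem hc' i)
  have hletter : ∀ j, ∃ s ∈ c ::ₘ M₁, letterCount s j = letterCount c₁ j := by
    intro j
    rcases hDcount j with h | h
    · exact ⟨c, by simp, h.symm⟩
    · rw [h]
      exact hM.exists_letterCount_eq hM' hn hcont hc' j
  choose t htM ht using hrow
  choose s hsM hs using hletter
  let F : Finset (Fin n → Fin k) := insert c (D.image t ∪ Finset.univ.image s)
  have hFM : F.val ≤ c ::ₘ M₁ := by
    rw [Multiset.le_iff_subset F.nodup]
    intro x hx
    simp only [F, Finset.mem_val, Finset.mem_insert, Finset.mem_union, Finset.mem_image,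
      Finset.mem_univ, true_and] at hx
    rcases hx with rfl | ⟨i, -, rfl⟩ | ⟨j, rfl⟩
    · simp
    · exact htM i
    · exact hsM j
  obtain ⟨N, hN⟩ := Multiset.le_iff_exists_add.1 hFM
  have hle : colExp c₁ ≤ content F.val := by
    refine colExp_le fun i => ?_
    by_cases hi : i ∈ D
    · rw [hc₁, Finset.piecewise_eq_of_mem _ _ _ hi, ← ht i]
      refine content_pos_of_mem ?_ i
      simp only [F, Finset.mem_val, Finset.mem_insert, Finset.mem_union, Finset.mem_image]
      exact Or.inr (Or.inl ⟨i, hi, rfl⟩)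
    · rw [hc₁, Finset.piecewise_eq_of_notMem _ _ _ hi]
      exact content_pos_of_mem (by simp [F]) i
  have hcF : c ∈ F.val := by simp [F]
  obtain ⟨T₀, hT₀⟩ := Multiset.exists_cons_of_mem hcF
  obtain ⟨T₁, hT₁card, hT₁⟩ := exists_content_eq (d := T₀.card) (e := content F.val - colExp c₁) (by
    intro i
    have h1 := sum_content_row F.val i
    rw [← tsub_add_cancel_of_le hle] at h1
    simp only [Finsupp.add_apply, Finset.sum_add_distrib, colExp_apply, Finset.sum_ite_eq,
      Finset.mem_univ, if_true] at h1
    rw [hT₀, Multiset.card_cons, ← hT₀] at h1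
    omega)
  obtain ⟨T, hT, hTbal, -⟩ := exists_isBalanced T₁
  have hcT : content (c₁ ::ₘ T) = content F.val := by
    rw [content_cons, hT, hT₁, add_tsub_cancel_of_le hle]
  have hTlevel : HasLevel q T := by
    have hbounds : ∀ j, T.card * q j ≤ (T.map (letterCount · j)).sum ∧
        (T.map (letterCount · j)).sum ≤ T.card * (q j + 1) := by
      intro j
      have hsF : s j ∈ F.val := by simp [F]
      obtain ⟨U, hU⟩ := Multiset.exists_cons_of_mem hsF
      have hUlevel : HasLevel q U :=
        hM.of_le ((Multiset.le_cons_self U (s j)).trans (hU ▸ hFM))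
      have hsum := sum_letterCount_eq_of_content_eq hcT j
      have hcard := card_eq_of_content_eq hn hcT
      rw [hU] at hsum hcard
      simp only [Multiset.map_cons, Multiset.sum_cons, Multiset.card_cons, hs j] at hsum hcard
      rw [add_left_cancel hsum, Nat.add_right_cancel hcard]
      exact ⟨hUlevel.card_mul_le j, hUlevel.le_card_mul j⟩
    exact hTbal.hasLevel (fun j => (hbounds j).1) fun j => (hbounds j).2
  refine ⟨c₁, T + N, ⟨hM, ?_, N, F.val, c₁ ::ₘ T, hN, by simp, hcT.symm, ?_⟩, ?_⟩
  · exact (hTlevel.add (hM.of_le (hN ▸ Multiset.le_add_left _ _))).cons hc₁q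
  · refine (Finset.card_insert_le _ _).trans (Nat.add_le_add_right ?_ 1)
    refine (Finset.card_union_le _ _).trans (add_le_add ?_ ?_)
    · exact Finset.card_image_le.trans hDcard
    · exact Finset.card_image_le.trans (by simp)
  · refine Finset.card_lt_card (Finset.ssubset_iff_subset_ne.2 ⟨fun i hi => ?_, fun heq => ?_⟩)
    · by_cases hiD : i ∈ D
      · simp [hc₁, Finset.piecewise_eq_of_mem _ _ _ hiD] at hi
      · simpa [hc₁, Finset.piecewise_eq_of_notMem _ _ _ hiD] using hi
    · obtain ⟨i, hi⟩ := hDne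
      have : i ∈ Finset.univ.filter fun i => c i ≠ c' i := by simpa using hDdiff i hi
      rw [← heq] at this
      simp [hc₁, Finset.piecewise_eq_of_mem _ _ _ hi] at this

/-- Column multisets of the same level and content are connected by moves of bounded size. -/
theorem exists_colMove_connected (k : ℕ) : ∃ C : ℕ, ∀ {n : ℕ} (_ : 0 < n) {q : Fin k → ℕ}
    {M M' : Multiset (Fin n → Fin k)}, HasLevel q M → HasLevel q M' → content M = content M' →
    Relation.ReflTransGen (ColMove C q) M M' := by
  obtain ⟨C, hC⟩ := exists_colMove_toward k
  refine ⟨C, fun {n} hn {q M M'} hM hM' hcont => ?_⟩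
  have step : ∀ (m : ℕ) {c c' : Fin n → Fin k} {M₁ M' : Multiset (Fin n → Fin k)},
      (Finset.univ.filter fun i => c i ≠ c' i).card = m → HasLevel q (c ::ₘ M₁) →
      HasLevel q M' → content (c ::ₘ M₁) = content M' → c' ∈ M' →
      ∃ M₂, HasLevel q (c' ::ₘ M₂) ∧ content (c' ::ₘ M₂) = content M' ∧
        Relation.ReflTransGen (ColMove C q) (c ::ₘ M₁) (c' ::ₘ M₂) := by
    intro m
    induction m using Nat.strong_induction_on with
    | _ m ih =>
      intro c c' M₁ M' hm hM hM' hcont hc'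
      rcases eq_or_ne c c' with rfl | hne
      · exact ⟨M₁, hM, hcont, .refl⟩
      · obtain ⟨c₁, M₂, hmove, hlt⟩ := hC hn hM hM' hcont hc' hne
        obtain ⟨M₃, h1, h2, h3⟩ := ih _ (hm ▸ hlt) rfl hmove.2.1 hM'
          (hmove.content_eq.symm.trans hcont) hc'
        exact ⟨M₃, h1, h2, .head hmove h3⟩
  induction M' using Multiset.induction generalizing M with
  | empty =>
    have : M = 0 := Multiset.card_eq_zero.1 (card_eq_of_content_eq hn hcont)
    rw [this]
  | cons c' M'₁ ih =>
    have hpos : 0 < M.card := by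
      rw [card_eq_of_content_eq hn hcont]
      simp
    obtain ⟨c, hc⟩ := Multiset.card_pos_iff_exists_mem.1 hpos
    obtain ⟨M₁, rfl⟩ := Multiset.exists_cons_of_mem hc
    obtain ⟨M₂, h1, h2, h3⟩ := step _ rfl hM hM' hcont (Multiset.mem_cons_self c' M'₁)
    rw [content_cons, content_cons] at h2
    have h4 := ih (h1.of_le (Multiset.le_cons_self _ _)) (hM'.of_le (Multiset.le_cons_self _ _))
      (add_left_cancel h2)
    exact h3.trans (h4.lift (c' ::ₘ ·) fun _ _ h => h.cons (hM' c' (by simp)))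

end Moves

theorem Multiset.exists_le_sum_of_le_sum {α : Type*} {𝒢 : Multiset (Multiset α)}
    {g : Multiset α} (h : g ≤ 𝒢.sum) : ∃ 𝒰 ≤ 𝒢, 𝒰.card ≤ g.card ∧ g ≤ 𝒰.sum := by
  classical
  induction 𝒢 using Multiset.induction generalizing g with
  | empty => exact ⟨0, le_rfl, by simp, h⟩
  | cons a 𝒢 ih =>
    rw [Multiset.sum_cons] at h
    by_cases h' : g ≤ 𝒢.sum
    · obtain ⟨𝒰, h1, h2, h3⟩ := ih h'
      exact ⟨𝒰, h1.trans (Multiset.le_cons_self _ _), h2, h3⟩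
    · obtain ⟨𝒰, h1, h2, h3⟩ := ih (g := g - a) (tsub_le_iff_left.2 h)
      have hlt : (g - a).card < g.card := by
        refine Multiset.card_lt_card (lt_of_le_of_ne tsub_le_self fun heq => h' ?_)
        rw [← heq]
        exact tsub_le_iff_left.2 h
      exact ⟨a ::ₘ 𝒰, Multiset.cons_le_cons a h1, by rw [Multiset.card_cons]; omega,
        by rw [Multiset.sum_cons]; exact tsub_le_iff_left.1 h3⟩

section Groupings

variable {n k r : ℕ}

/-- A multiset of zero-weight groups of at most `d₀` columns. -/
def IsGrouping (w : Fin k → Fin r → ℤ) (d₀ : ℕ) (𝒢 : Multiset (Multiset (Fin n → Fin k))) : Prop :=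
  ∀ g ∈ 𝒢, g.card ≤ d₀ ∧ (g.map (colWeight w)).sum = 0

/-- Any nonempty zero-weight multiset of columns with weights bounded by `R` contains a nonempty
zero-weight multiset of at most `d₀` columns. -/
def SplitsWithin (w : Fin k → Fin r → ℤ) (R d₀ n : ℕ) : Prop :=
  ∀ M : Multiset (Fin n → Fin k), (∀ c ∈ M, ∀ l, |colWeight w c l| ≤ R) → M ≠ 0 →
    (M.map (colWeight w)).sum = 0 →
    ∃ g ≤ M, g ≠ 0 ∧ (g.map (colWeight w)).sum = 0 ∧ g.card ≤ d₀

variable {w : Fin k → Fin r → ℤ} {R d₀ : ℕ}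

theorem IsGrouping.of_le {𝒢 ℋ : Multiset (Multiset (Fin n → Fin k))} (h : IsGrouping w d₀ 𝒢)
    (hle : ℋ ≤ 𝒢) : IsGrouping w d₀ ℋ := fun g hg => h g (Multiset.mem_of_le hle hg)

theorem IsGrouping.add {𝒢 ℋ : Multiset (Multiset (Fin n → Fin k))} (h : IsGrouping w d₀ 𝒢)
    (h' : IsGrouping w d₀ ℋ) : IsGrouping w d₀ (𝒢 + ℋ) := fun g hg =>
  (Multiset.mem_add.1 hg).elim (h g) (h' g)

theorem IsGrouping.cons {𝒢 : Multiset (Multiset (Fin n → Fin k))} {g : Multiset (Fin n → Fin k)}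
    (hg : g.card ≤ d₀ ∧ (g.map (colWeight w)).sum = 0) (h : IsGrouping w d₀ 𝒢) :
    IsGrouping w d₀ (g ::ₘ 𝒢) := fun g' hg' =>
  (Multiset.mem_cons.1 hg').elim (fun e => e ▸ hg) (h g')

theorem IsGrouping.card_sum_le {𝒢 : Multiset (Multiset (Fin n → Fin k))}
    (h : IsGrouping w d₀ 𝒢) : 𝒢.sum.card ≤ 𝒢.card * d₀ := by
  induction 𝒢 using Multiset.induction with
  | empty => simp
  | cons g 𝒢 ih =>
    have h1 := (h g (by simp)).1
    have h2 := ih (h.of_le (Multiset.le_cons_self _ _))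
    rw [Multiset.sum_cons, Multiset.card_add, Multiset.card_cons, add_mul]
    omega

theorem IsGrouping.sum_colWeight {𝒢 : Multiset (Multiset (Fin n → Fin k))}
    (h : IsGrouping w d₀ 𝒢) : (𝒢.sum.map (colWeight w)).sum = 0 := by
  induction 𝒢 using Multiset.induction with
  | empty => simp
  | cons g 𝒢 ih =>
    rw [Multiset.sum_cons, Multiset.map_add, Multiset.sum_add, (h g (by simp)).2,
      ih (h.of_le (Multiset.le_cons_self _ _)), add_zero]

theorem SplitsWithin.exists_isGrouping (hs : SplitsWithin w R d₀ n)
    {M : Multiset (Fin n → Fin k)} (hM : ∀ c ∈ M, ∀ l, |colWeight w c l| ≤ R)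
    (h0 : (M.map (colWeight w)).sum = 0) : ∃ 𝒢, IsGrouping w d₀ 𝒢 ∧ 𝒢.sum = M := by
  induction hm : M.card using Nat.strong_induction_on generalizing M with
  | _ m ih =>
    rcases eq_or_ne M 0 with rfl | hne
    · exact ⟨0, by simp [IsGrouping], by simp⟩
    · obtain ⟨g, hle, hg, hg0, hcard⟩ := hs M hM hne h0
      obtain ⟨N, rfl⟩ := Multiset.le_iff_exists_add.1 hle
      rw [Multiset.map_add, Multiset.sum_add, hg0, zero_add] at h0
      have := Multiset.card_pos.2 hg
      obtain ⟨𝒢, h1, h2⟩ := ih N.card (by rw [← hm, Multiset.card_add]; omega)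
        (fun c hc => hM c (by simp [hc])) h0 rfl
      exact ⟨g ::ₘ 𝒢, h1.cons ⟨hcard, hg0⟩, by simp [h2]⟩

variable {Q : Type*} [CommMonoid Q] {X : Multiset (Fin n → Fin k) → Q} {d₁ : ℕ}

/-- Groupings of the same content have the same value, provided that the content has degree at
most `d₁`. -/
def RespectsContent (w : Fin k → Fin r → ℤ) (d₀ d₁ : ℕ) (X : Multiset (Fin n → Fin k) → Q) :
    Prop :=
  ∀ 𝒢 ℋ, IsGrouping w d₀ 𝒢 → IsGrouping w d₀ ℋ → content 𝒢.sum = content ℋ.sum →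
    𝒢.sum.card ≤ d₁ → (𝒢.map X).prod = (ℋ.map X).prod

theorem RespectsContent.prod_eq_of_sum_eq (hX : RespectsContent w d₀ d₁ X)
    (hs : SplitsWithin w R d₀ n) (hd : d₀ * d₀ ≤ d₁) {𝒢 ℋ : Multiset (Multiset (Fin n → Fin k))}
    (h𝒢 : IsGrouping w d₀ 𝒢) (hℋ : IsGrouping w d₀ ℋ) (hsum : 𝒢.sum = ℋ.sum)
    (hR : ∀ c ∈ 𝒢.sum, ∀ l, |colWeight w c l| ≤ R) : (𝒢.map X).prod = (ℋ.map X).prod := by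
  induction ℋ using Multiset.induction generalizing 𝒢 with
  | empty => exact hX _ _ h𝒢 hℋ (by rw [hsum]) (by simp [hsum])
  | cons g ℋ ih =>
    have hg := hℋ g (by simp)
    obtain ⟨𝒰, hle, hcard, hg𝒰⟩ := Multiset.exists_le_sum_of_le_sum (𝒢 := 𝒢) (g := g)
      (by rw [hsum, Multiset.sum_cons]; exact Multiset.le_add_right _ _)
    obtain ⟨𝒱, rfl⟩ := Multiset.le_iff_exists_add.1 hle
    have h𝒰 := h𝒢.of_le hle
    have h𝒱 := h𝒢.of_le (Multiset.le_add_left 𝒱 𝒰)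
    obtain ⟨N, hN⟩ := Multiset.le_iff_exists_add.1 hg𝒰
    have hN0 := h𝒰.sum_colWeight
    rw [hN, Multiset.map_add, Multiset.sum_add, hg.2, zero_add] at hN0
    obtain ⟨𝒲, h𝒲, rfl⟩ := hs.exists_isGrouping (M := N)
      (fun c hc => hR c (by simp [hN, hc])) hN0
    have h1 : (𝒰.map X).prod = ((g ::ₘ 𝒲).map X).prod :=
      hX _ _ h𝒰 (h𝒲.cons hg) (by simp [hN])
        (h𝒰.card_sum_le.trans ((Nat.mul_le_mul_right _ (hcard.trans hg.1)).trans hd))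
    rw [Multiset.sum_add, hN, Multiset.sum_cons, add_assoc] at hsum
    have hsum' := add_left_cancel hsum
    have h2 := ih (h𝒲.add h𝒱) (hℋ.of_le (Multiset.le_cons_self _ _)) (by simpa using hsum')
      (fun c hc => hR c (by
        rw [Multiset.sum_add, hN, add_assoc, ← Multiset.sum_add]
        exact Multiset.mem_add.2 (Or.inr hc)))
    rw [Multiset.map_add, Multiset.prod_add, h1, Multiset.map_cons, Multiset.prod_cons,
      Multiset.map_cons, Multiset.prod_cons, ← h2, Multiset.map_add, Multiset.prod_add, mul_assoc]

theorem IsBalanced.colWeight_bound (hR : ∀ l, ∑ j, |w j l| ≤ (R : ℤ))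
    {M : Multiset (Fin n → Fin k)} (hM : IsBalanced M) (h0 : (M.map (colWeight w)).sum = 0) :
    ∀ c ∈ M, ∀ l, |colWeight w c l| ≤ R := fun _ hc l =>
  (hM.abs_colWeight_le h0 hc l).trans (hR l)

theorem RespectsContent.exists_isBalanced (hX : RespectsContent w d₀ d₁ X)
    (hs : SplitsWithin w R d₀ n) (hR : ∀ l, ∑ j, |w j l| ≤ (R : ℤ)) (hd : 2 * d₀ ≤ d₁)
    {𝒢 : Multiset (Multiset (Fin n → Fin k))} (h𝒢 : IsGrouping w d₀ 𝒢) :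
    ∃ ℋ, IsGrouping w d₀ ℋ ∧ content ℋ.sum = content 𝒢.sum ∧ IsBalanced ℋ.sum ∧
      (ℋ.map X).prod = (𝒢.map X).prod := by
  induction hE : energy 𝒢.sum using Nat.strong_induction_on generalizing 𝒢 with
  | _ E ih =>
    by_cases hbal : IsBalanced 𝒢.sum
    · exact ⟨𝒢, h𝒢, rfl, hbal, rfl⟩
    have hbad := hbal
    simp only [IsBalanced, not_forall, not_le] at hbad
    obtain ⟨c, hc, c', hc', j, hj⟩ := hbad
    have hne : c' ≠ c := by
      rintro rfl
      omega
    have hpair : ({c, c'} : Multiset (Fin n → Fin k)) ≤ 𝒢.sum := by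
      rw [Multiset.le_iff_subset (by simp [hne.symm])]
      intro x hx
      simp only [Multiset.insert_eq_cons, Multiset.mem_cons, Multiset.mem_singleton] at hx
      rcases hx with rfl | rfl <;> assumption
    obtain ⟨𝒰, hle, hcard, hp𝒰⟩ := Multiset.exists_le_sum_of_le_sum hpair
    obtain ⟨𝒱, rfl⟩ := Multiset.le_iff_exists_add.1 hle
    have h𝒰 := h𝒢.of_le hle
    have h𝒱 := h𝒢.of_le (Multiset.le_add_left 𝒱 𝒰)
    have hunbal : ¬ IsBalanced 𝒰.sum := fun h => by
      have := h c (Multiset.mem_of_le hp𝒰 (by simp)) c' (Multiset.mem_of_le hp𝒰 (by simp)) j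
      omega
    obtain ⟨K, hK, hKbal, -, hlt⟩ := _root_.exists_isBalanced 𝒰.sum
    have hK0 := (sum_colWeight_eq_of_content_eq w hK).trans h𝒰.sum_colWeight
    obtain ⟨𝒲, h𝒲, rfl⟩ := hs.exists_isGrouping (hKbal.colWeight_bound hR hK0) hK0
    have h1 : (𝒰.map X).prod = (𝒲.map X).prod := hX _ _ h𝒰 h𝒲 hK.symm
      (h𝒰.card_sum_le.trans ((Nat.mul_le_mul_right _ hcard).trans (by simpa using hd)))
    have henergy : energy (𝒲 + 𝒱).sum < E := by
      have := hlt hunbal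
      simp only [energy, Multiset.sum_add, Multiset.map_add] at this hE ⊢
      omega
    obtain ⟨ℋ, hℋ, hcont, hbal', hprod⟩ := ih _ henergy (h𝒲.add h𝒱) rfl
    refine ⟨ℋ, hℋ, ?_, hbal', ?_⟩
    · rw [hcont]
      simp [hK]
    · rw [hprod]
      simp [h1]

theorem RespectsContent.exists_of_colMove (hX : RespectsContent w d₀ d₁ X)
    (hs : SplitsWithin w R d₀ n) (hR : ∀ l, ∑ j, |w j l| ≤ (R : ℤ)) {C : ℕ} (hd : C * d₀ ≤ d₁)
    {q : Fin k → ℕ} {M' : Multiset (Fin n → Fin k)}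
    {𝒢 : Multiset (Multiset (Fin n → Fin k))} (h𝒢 : IsGrouping w d₀ 𝒢)
    (hmove : ColMove C q 𝒢.sum M') :
    ∃ ℋ, IsGrouping w d₀ ℋ ∧ ℋ.sum = M' ∧ (ℋ.map X).prod = (𝒢.map X).prod := by
  have hM'0 := (sum_colWeight_eq_of_content_eq w hmove.content_eq).symm.trans h𝒢.sum_colWeight
  obtain ⟨h1, h2, N, K, K', hsum, rfl, hK, hC⟩ := hmove
  have hM'R := h2.isBalanced.colWeight_bound hR hM'0
  obtain ⟨𝒰, hle, hcard, hK𝒰⟩ := Multiset.exists_le_sum_of_le_sum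
    (hsum ▸ Multiset.le_add_right K N : K ≤ 𝒢.sum)
  obtain ⟨𝒱, rfl⟩ := Multiset.le_iff_exists_add.1 hle
  have h𝒰 := h𝒢.of_le hle
  have h𝒱 := h𝒢.of_le (Multiset.le_add_left 𝒱 𝒰)
  obtain ⟨L, hL⟩ := Multiset.le_iff_exists_add.1 hK𝒰
  rw [Multiset.sum_add, hL, add_assoc] at hsum
  have hN : L + 𝒱.sum = N := add_left_cancel hsum
  have hcont : content 𝒰.sum = content (K' + L) := by simp [hL, hK]
  obtain ⟨𝒲, h𝒲, h𝒲sum⟩ := hs.exists_isGrouping (M := K' + L)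
    (fun c hc => hM'R c (by
      rw [← hN, ← add_assoc]
      exact Multiset.mem_add.2 (Or.inl hc)))
    ((sum_colWeight_eq_of_content_eq w hcont).symm.trans h𝒰.sum_colWeight)
  refine ⟨𝒲 + 𝒱, h𝒲.add h𝒱, by rw [Multiset.sum_add, h𝒲sum, add_assoc, hN], ?_⟩
  rw [Multiset.map_add, Multiset.prod_add, Multiset.map_add, Multiset.prod_add,
    hX 𝒰 𝒲 h𝒰 h𝒲 (hcont.trans (by rw [h𝒲sum]))
      (h𝒰.card_sum_le.trans ((Nat.mul_le_mul_right _ (hcard.trans hC)).trans hd))]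

theorem IsBalanced.hasLevel_div {M : Multiset (Fin n → Fin k)} (h : IsBalanced M) :
    HasLevel (fun j => (M.map (letterCount · j)).sum / M.card) M := by
  rcases eq_or_ne M 0 with rfl | hne
  · simp [HasLevel]
  · have hpos := Multiset.card_pos.2 hne
    exact h.hasLevel (fun j => Nat.mul_div_le _ _)
      fun j => (Nat.lt_mul_div_succ _ hpos).le

theorem RespectsContent.prod_eq (hX : RespectsContent w d₀ d₁ X) (hn : 0 < n)
    (hs : SplitsWithin w R d₀ n) (hR : ∀ l, ∑ j, |w j l| ≤ (R : ℤ)) {C : ℕ}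
    (hC : ∀ {q : Fin k → ℕ} {M M' : Multiset (Fin n → Fin k)}, HasLevel q M → HasLevel q M' →
      content M = content M' → Relation.ReflTransGen (ColMove C q) M M')
    (hd : (2 + d₀ + C) * d₀ ≤ d₁) {𝒢 ℋ : Multiset (Multiset (Fin n → Fin k))}
    (h𝒢 : IsGrouping w d₀ 𝒢) (hℋ : IsGrouping w d₀ ℋ) (hcont : content 𝒢.sum = content ℋ.sum) :
    (𝒢.map X).prod = (ℋ.map X).prod := by
  have hd1 : 2 * d₀ ≤ d₁ := (Nat.mul_le_mul_right _ (by omega)).trans hd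
  have hd2 : d₀ * d₀ ≤ d₁ := (Nat.mul_le_mul_right _ (by omega)).trans hd
  have hd3 : C * d₀ ≤ d₁ := (Nat.mul_le_mul_right _ (by omega)).trans hd
  obtain ⟨𝒢₁, h𝒢₁, hc𝒢, hb𝒢, hp𝒢⟩ := hX.exists_isBalanced hs hR hd1 h𝒢
  obtain ⟨ℋ₁, hℋ₁, hcℋ, hbℋ, hpℋ⟩ := hX.exists_isBalanced hs hR hd1 hℋ
  have hcont₁ : content 𝒢₁.sum = content ℋ₁.sum := by rw [hc𝒢, hcℋ, hcont]
  have hlevel := hbℋ.hasLevel_div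
  simp only [← card_eq_of_content_eq hn hcont₁, ← sum_letterCount_eq_of_content_eq hcont₁]
    at hlevel
  have key : ∀ {M}, Relation.ReflTransGen
      (ColMove C fun j => (𝒢₁.sum.map (letterCount · j)).sum / 𝒢₁.sum.card) 𝒢₁.sum M →
      ∃ 𝒦, IsGrouping w d₀ 𝒦 ∧ 𝒦.sum = M ∧ (𝒦.map X).prod = (𝒢₁.map X).prod := by
    intro M h
    induction h with
    | refl => exact ⟨𝒢₁, h𝒢₁, rfl, rfl⟩
    | tail _ hmove ih =>
      obtain ⟨𝒦, h𝒦, rfl, hprod⟩ := ih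
      obtain ⟨𝒦', h1, h2, h3⟩ := hX.exists_of_colMove hs hR hd3 h𝒦 hmove
      exact ⟨𝒦', h1, h2, h3.trans hprod⟩
  obtain ⟨𝒦, h𝒦, hsum, hprod⟩ := key (hC hb𝒢.hasLevel_div hlevel hcont₁)
  rw [← hp𝒢, ← hpℋ, ← hprod]
  refine hX.prod_eq_of_sum_eq hs hd2 h𝒦 hℋ₁ hsum ?_
  rw [hsum]
  exact hbℋ.colWeight_bound hR hℋ₁.sum_colWeight

end Groupings

section Presentation

variable {n k r : ℕ} {w : Fin k → Fin r → ℤ} {R d₀ : ℕ}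

open Classical in
/-- The indeterminate indexed by the content of a group of columns. -/
noncomputable def groupIndet (w : Fin k → Fin r → ℤ) (d₀ : ℕ) (g : Multiset (Fin n → Fin k)) :
    MvPolynomial (IndexSet r n k w d₀) ℂ :=
  if h : g.card ≤ d₀ ∧ (g.map (colWeight w)).sum = 0 then
    X ⟨content g, (invariantMon_content w g).2 h.2, g.card, h.1, multiHomog_content g⟩
  else 1

theorem presentationMap_X (v : IndexSet r n k w d₀) :
    presentationMap r n k w d₀ (X v) = monomial v.1 1 :=
  aeval_X _ v

theorem presentationMap_prod_groupIndet {𝒢 : Multiset (Multiset (Fin n → Fin k))}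
    (h : IsGrouping w d₀ 𝒢) :
    presentationMap r n k w d₀ (𝒢.map (groupIndet w d₀)).prod = monomial (content 𝒢.sum) 1 := by
  induction 𝒢 using Multiset.induction with
  | empty => simp
  | cons g 𝒢 ih =>
    rw [Multiset.map_cons, Multiset.prod_cons, map_mul, ih (h.of_le (Multiset.le_cons_self _ _)),
      groupIndet, dif_pos (h g (by simp)), Multiset.sum_cons, content_add]
    refine (congrArg (· * _) (presentationMap_X _)).trans ?_
    simp only [monomial_mul, one_mul]

theorem isWeightedHomogeneous_prod_groupIndet (hn : 0 < n)
    {𝒢 : Multiset (Multiset (Fin n → Fin k))} (h : IsGrouping w d₀ 𝒢) :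
    IsWeightedHomogeneous (indetDegree hn) (𝒢.map (groupIndet w d₀)).prod 𝒢.sum.card := by
  induction 𝒢 using Multiset.induction with
  | empty => simpa using isWeightedHomogeneous_one ℂ (indetDegree hn)
  | cons g 𝒢 ih =>
    rw [Multiset.map_cons, Multiset.prod_cons, Multiset.sum_cons, Multiset.card_add]
    refine IsWeightedHomogeneous.mul ?_ (ih (h.of_le (Multiset.le_cons_self _ _)))
    rw [groupIndet, dif_pos (h g (by simp)), ← sum_content_row g ⟨0, hn⟩]
    exact isWeightedHomogeneous_X ℂ (indetDegree hn) _

theorem exists_groupIndet_eq_X (v : IndexSet r n k w d₀) :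
    ∃ g : Multiset (Fin n → Fin k), (g.card ≤ d₀ ∧ (g.map (colWeight w)).sum = 0) ∧
      groupIndet w d₀ g = X v := by
  obtain ⟨e, hinv, d, hd, hhom⟩ := v
  obtain ⟨g, rfl, rfl⟩ := exists_content_eq hhom
  have hg := And.intro hd ((invariantMon_content w g).1 hinv)
  exact ⟨g, hg, by rw [groupIndet, dif_pos hg]⟩

theorem exists_prod_groupIndet_eq_monomial (u : IndexSet r n k w d₀ →₀ ℕ) :
    ∃ 𝒢 : Multiset (Multiset (Fin n → Fin k)), IsGrouping w d₀ 𝒢 ∧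
      (𝒢.map (groupIndet w d₀)).prod = monomial u 1 := by
  induction u using Finsupp.induction_linear with
  | zero => exact ⟨0, by simp [IsGrouping], by simp⟩
  | add u u' ih ih' =>
    obtain ⟨𝒢, h, hp⟩ := ih
    obtain ⟨𝒢', h', hp'⟩ := ih'
    exact ⟨𝒢 + 𝒢', h.add h', by simp [hp, hp', monomial_mul]⟩
  | single v m =>
    obtain ⟨g, hg, hgX⟩ := exists_groupIndet_eq_X v
    refine ⟨Multiset.replicate m g, fun g' hg' => Multiset.eq_of_mem_replicate hg' ▸ hg, ?_⟩
    rw [Multiset.map_replicate, Multiset.prod_replicate, hgX, X_pow_eq_monomial]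

theorem range_presentationMap (hs : SplitsWithin w R d₀ n)
    (hR : ∀ l, ∑ j, |w j l| ≤ (R : ℤ)) :
    (presentationMap r n k w d₀).range = invariantRing r n k w := by
  apply le_antisymm
  · rw [presentationMap, ← Algebra.adjoin_range_eq_range_aeval, invariantRing]
    refine Algebra.adjoin_mono ?_
    rintro _ ⟨⟨e, hinv, d, -, hhom⟩, rfl⟩
    exact ⟨e, rfl, hinv, d, hhom⟩
  · refine Algebra.adjoin_le ?_
    rintro _ ⟨e, rfl, hinv, d, hhom⟩
    obtain ⟨M, -, rfl⟩ := exists_content_eq hhom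
    obtain ⟨M', hcont, hbal, -⟩ := exists_isBalanced M
    rw [← hcont] at hinv ⊢
    have h0 := (invariantMon_content w M').1 hinv
    obtain ⟨𝒢, h𝒢, rfl⟩ := hs.exists_isGrouping (hbal.colWeight_bound hR h0) h0
    exact ⟨_, presentationMap_prod_groupIndet h𝒢⟩

/-- If monomials with equal image are congruent modulo an ideal, then the ideal contains the
kernel of the presentation map. -/
theorem ker_presentationMap_le {I : Ideal (MvPolynomial (IndexSet r n k w d₀) ℂ)}
    (h : ∀ 𝒢 ℋ : Multiset (Multiset (Fin n → Fin k)), IsGrouping w d₀ 𝒢 → IsGrouping w d₀ ℋ →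
      content 𝒢.sum = content ℋ.sum →
      Ideal.Quotient.mkₐ ℂ I (𝒢.map (groupIndet w d₀)).prod =
        Ideal.Quotient.mkₐ ℂ I (ℋ.map (groupIndet w d₀)).prod) :
    RingHom.ker (presentationMap r n k w d₀).toRingHom ≤ I := by
  classical
  let F : (Fin n × Fin k →₀ ℕ) → MvPolynomial (IndexSet r n k w d₀) ℂ ⧸ I := fun e =>
    if he : ∃ 𝒢 : Multiset (Multiset (Fin n → Fin k)), IsGrouping w d₀ 𝒢 ∧ content 𝒢.sum = e then
      Ideal.Quotient.mkₐ ℂ I (he.choose.map (groupIndet w d₀)).prod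
    else 0
  let L := (basisMonomials (Fin n × Fin k) ℂ).constr ℂ F
  have hL : L ∘ₗ (presentationMap r n k w d₀).toLinearMap =
      (Ideal.Quotient.mkₐ ℂ I).toLinearMap := by
    refine (basisMonomials (IndexSet r n k w d₀) ℂ).ext fun u => ?_
    obtain ⟨𝒢, h𝒢, hu⟩ := exists_prod_groupIndet_eq_monomial u
    have he : ∃ 𝒢' : Multiset (Multiset (Fin n → Fin k)),
        IsGrouping w d₀ 𝒢' ∧ content 𝒢'.sum = content 𝒢.sum := ⟨𝒢, h𝒢, rfl⟩
    have hF : L (monomial (content 𝒢.sum) 1) = F (content 𝒢.sum) := by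
      have := (basisMonomials (Fin n × Fin k) ℂ).constr_basis ℂ F (content 𝒢.sum)
      rwa [coe_basisMonomials] at this
    simp only [coe_basisMonomials, LinearMap.comp_apply, AlgHom.toLinearMap_apply]
    rw [← hu, presentationMap_prod_groupIndet h𝒢, hF]
    simp only [F, dif_pos he]
    exact h _ _ he.choose_spec.1 h𝒢 he.choose_spec.2
  intro p hp
  have hp : presentationMap r n k w d₀ p = 0 := hp
  have := LinearMap.congr_fun hL p
  simp only [LinearMap.comp_apply, AlgHom.toLinearMap_apply, hp, map_zero] at this
  exact Ideal.Quotient.eq_zero_iff_mem.1 this.symm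

end Presentation

/-- There are positive integers `d₀, d₁`, independent of `n`, such
that for every `n ≥ 1` the presentation `π_n : P_n → ℂ[x_{ij}]` (with indeterminates
the invariant multi-homogeneous monomials of degree `≤ d₀`) has image `R_n`, and its
kernel is generated, as an ideal of `P_n`, by its elements of graded degree `≤ d₁`. -/
theorem invariant_ring_relations_bounded_degree
    (r k : ℕ) (hr : 0 < r) (hk : 0 < k) (w : Fin k → Fin r → ℤ) :
    ∃ d₀ d₁ : ℕ, 0 < d₀ ∧ 0 < d₁ ∧
      ∀ n : ℕ, ∀ hn : 0 < n,
        (presentationMap r n k w d₀).range = invariantRing r n k w ∧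
        RingHom.ker (presentationMap r n k w d₀).toRingHom =
          Ideal.span {p : MvPolynomial (IndexSet r n k w d₀) ℂ |
            p ∈ RingHom.ker (presentationMap r n k w d₀).toRingHom ∧
            weightedTotalDegree (indetDegree hn) p ≤ d₁} := by
  obtain ⟨N, hN⟩ := exists_zeroSum_bound r (∑ l, ∑ j, (w j l).natAbs)
  obtain ⟨C, hC⟩ := exists_colMove_connected k
  set R := ∑ l, ∑ j, (w j l).natAbs with hRdef
  have hR : ∀ l, ∑ j, |w j l| ≤ (R : ℤ) := fun l => by
    have := Finset.single_le_sum (f := fun l => ∑ j, (w j l).natAbs) (fun _ _ => Nat.zero_le _)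
      (Finset.mem_univ l)
    rw [← hRdef] at this
    zify at this
    exact this
  refine ⟨N + 1, (2 + (N + 1) + C) * (N + 1), by omega, by positivity, fun n hn => ?_⟩
  have hs : SplitsWithin w R (N + 1) n := fun M hM hne h0 => by
    obtain ⟨g, hle, hg, hg0, hcard⟩ := hN M (colWeight w) hM hne h0
    exact ⟨g, hle, hg, hg0, hcard.trans N.le_succ⟩
  refine ⟨range_presentationMap hs hR, le_antisymm ?_ (Ideal.span_le.2 fun p hp => hp.1)⟩
  set I := Ideal.span {p : MvPolynomial (IndexSet r n k w (N + 1)) ℂ |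
    p ∈ RingHom.ker (presentationMap r n k w (N + 1)).toRingHom ∧
      weightedTotalDegree (indetDegree hn) p ≤ (2 + (N + 1) + C) * (N + 1)}
  have hX : RespectsContent w (N + 1) ((2 + (N + 1) + C) * (N + 1))
      fun g : Multiset (Fin n → Fin k) => Ideal.Quotient.mkₐ ℂ I (groupIndet w (N + 1) g) := by
    intro 𝒢 ℋ h𝒢 hℋ hcont hcard
    have hmap : ∀ 𝒦 : Multiset (Multiset (Fin n → Fin k)),
        (𝒦.map fun g => Ideal.Quotient.mkₐ ℂ I (groupIndet w (N + 1) g)).prod =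
          Ideal.Quotient.mkₐ ℂ I (𝒦.map (groupIndet w (N + 1))).prod := fun 𝒦 => by
      rw [map_multiset_prod, Multiset.map_map]
      rfl
    rw [hmap, hmap]
    refine Ideal.Quotient.eq.2 (Ideal.subset_span ⟨?_, ?_⟩)
    · refine (map_sub (presentationMap r n k w (N + 1)) _ _).trans ?_
      rw [presentationMap_prod_groupIndet h𝒢, presentationMap_prod_groupIndet hℋ, hcont, sub_self]
    · have hhom := (isWeightedHomogeneous_prod_groupIndet hn h𝒢).sub
        ((card_eq_of_content_eq hn hcont) ▸ isWeightedHomogeneous_prod_groupIndet hn hℋ)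
      exact Finset.sup_le fun d hd => (hhom (mem_support_iff.1 hd)).trans_le hcard
  refine ker_presentationMap_le fun 𝒢 ℋ h𝒢 hℋ hcont => ?_
  have := hX.prod_eq hn hs hR (hC hn) le_rfl h𝒢 hℋ hcont
  rw [map_multiset_prod, map_multiset_prod, Multiset.map_map, Multiset.map_map]
  exact this
end

section
/- There exists a positive integer d_0, depending only on r, k and the weight vectors w_1,…,w_k (and not on n), such that for every positive integer n the algebra R_n is generated as a ℂ-algebra by the invariant multi-homogeneous monomials of degree at most d_0. -/
open MvPolynomial

/-- The set of invariant multi-homogeneous monomials (of any degree) in `ℂ[x_{ij}]`. -/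
def invMonomials (r n k : ℕ) (w : Fin k → Fin r → ℤ) :
    Set (MvPolynomial (Fin n × Fin k) ℂ) :=
  {p | ∃ e : Fin n × Fin k →₀ ℕ, p = monomial e 1 ∧
    InvariantMon r n k w e ∧ ∃ d : ℕ, MultiHomog n k d e}

/-- The set of invariant multi-homogeneous monomials of degree at most `d₀`. -/
def invMonomialsUpTo (r n k : ℕ) (w : Fin k → Fin r → ℤ) (d₀ : ℕ) :
    Set (MvPolynomial (Fin n × Fin k) ℂ) :=
  {p | ∃ e : Fin n × Fin k →₀ ℕ, p = monomial e 1 ∧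
    InvariantMon r n k w e ∧ ∃ d : ℕ, d ≤ d₀ ∧ MultiHomog n k d e}

open Finset in
/-- The number of rows `i` of the array `L` whose entry in column `t` is `j`. -/
def colCount {ι τ α : Type*} [Fintype ι] [DecidableEq α] (L : ι → τ → α) (t : τ) (j : α) : ℤ :=
  ∑ i, if L i t = j then 1 else 0

open Finset in
theorem sum_colCount_smul {ι τ α M : Type*} [Fintype ι] [Fintype α] [DecidableEq α]
    [AddCommGroup M] (L : ι → τ → α) (t : τ) (f : α → M) :
    ∑ j, colCount L t j • f j = ∑ i, f (L i t) := by
  simp only [colCount, Finset.sum_smul, ite_smul, one_smul, zero_smul]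
  rw [Finset.sum_comm]
  simp

open Finset in
/-- If exchanging the entries of row `i` in columns `s` and `t` does not decrease the sum of squared
column counts, the count differences at these two entries satisfy a step bound. -/
theorem colCount_le_of_energy_le {ι τ α : Type*} [Fintype ι] [Fintype τ] [Fintype α]
    [DecidableEq ι] [DecidableEq τ] [DecidableEq α] (L : ι → τ → α) (i : ι) {s t : τ} (hst : s ≠ t)
    (hmin : ∑ u, ∑ j, colCount L u j ^ 2 ≤ ∑ u, ∑ j,
      colCount (Function.update L i (L i ∘ Equiv.swap s t)) u j ^ 2) :
    colCount L s (L i s) - colCount L t (L i s) ≤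
      colCount L s (L i t) - colCount L t (L i t) + 2 := by
  set L' := Function.update L i (L i ∘ Equiv.swap s t) with hL'
  let ind : α → α → ℤ := fun a j => if a = j then 1 else 0
  have hcc : ∀ u j, colCount L' u j =
      colCount L u j + (ind (L i (Equiv.swap s t u)) j - ind (L i u) j) := by
    intro u j
    rw [← sub_eq_iff_eq_add']
    simp only [colCount, ← Finset.sum_sub_distrib]
    rw [Finset.sum_eq_single i]
    · simp [hL', ind]
    · intro i' _ hi'
      simp [hL', hi']
    · simp
  let g : τ → ℤ := fun u => ∑ j, (colCount L' u j ^ 2 - colCount L u j ^ 2)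
  have hg : 0 ≤ ∑ u, g u := by
    simp only [g, Finset.sum_sub_distrib]
    linarith
  have hg2 : ∑ u, g u = g s + g t := by
    rw [← Finset.sum_pair hst]
    symm
    apply Finset.sum_subset (Finset.subset_univ _)
    intro u _ hu
    simp only [Finset.mem_insert, Finset.mem_singleton, not_or] at hu
    simp [g, hcc, Equiv.swap_apply_of_ne_of_ne hu.1 hu.2]
  have key : ∀ (v : α → ℤ) (a b : α),
      ∑ j, ((v j + (ind b j - ind a j)) ^ 2 - v j ^ 2) ≤ 2 * (v b - v a) + 2 := by
    intro v a b
    calc ∑ j, ((v j + (ind b j - ind a j)) ^ 2 - v j ^ 2)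
        ≤ ∑ j, (2 * (ind b j * v j - ind a j * v j) + (ind b j + ind a j)) := by
          apply Finset.sum_le_sum
          intro j _
          simp only [ind]
          split_ifs <;> nlinarith
      _ = _ := by
          simp [Finset.sum_add_distrib, ← Finset.mul_sum, ind]
  have h1 := key (colCount L s) (L i s) (L i t)
  have h2 := key (colCount L t) (L i t) (L i s)
  rw [hg2] at hg
  simp only [g, hcc, Equiv.swap_apply_left, Equiv.swap_apply_right] at hg
  linarith

open Finset in
/-- If the step bound holds along every row, two columns have uniformly close counts. -/
theorem colCount_sub_le {ι τ α : Type*} [Fintype ι] [Fintype α] [DecidableEq α]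
    (L : ι → τ → α) (s t : τ)
    (hstep : ∀ i, colCount L s (L i s) - colCount L t (L i s) ≤
      colCount L s (L i t) - colCount L t (L i t) + 2) (j : α) :
    colCount L s j - colCount L t j ≤ 2 * Fintype.card α := by
  by_contra! hlt
  set D : α → ℤ := fun j => colCount L s j - colCount L t j with hD
  let S : ℕ → Finset α := fun m => univ.filter fun a => D j - 2 * m ≤ D a
  have hmono : ∀ m, S m ⊆ S (m + 1) := by
    intro m a ha
    simp only [S, mem_filter, mem_univ, true_and] at ha ⊢
    push_cast
    linarith
  have hjS : ∀ m, j ∈ S m := by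
    intro m
    simp only [S, mem_filter, mem_univ, true_and]
    have : (0 : ℤ) ≤ m := by positivity
    linarith
  obtain ⟨m, hm, hSm⟩ : ∃ m < Fintype.card α, S (m + 1) = S m := by
    by_contra! hne
    have hcard : ∀ m ≤ Fintype.card α, m + 1 ≤ #(S m) := by
      intro m
      induction m with
      | zero => exact fun _ => Finset.card_pos.2 ⟨j, hjS 0⟩
      | succ m ih =>
        intro hm
        have h1 := Finset.card_lt_card ((hmono m).ssubset_of_ne (hne m (by omega)).symm)
        have h2 := ih (by omega)
        omega
    have h1 := hcard _ le_rfl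
    have h2 := Finset.card_le_univ (S (Fintype.card α))
    omega
  have hpos : ∀ a ∈ S m, 0 < D a := by
    intro a ha
    simp only [S, mem_filter, mem_univ, true_and] at ha
    have : (m : ℤ) < Fintype.card α := by exact_mod_cast hm
    have : 2 * (Fintype.card α : ℤ) < D j := hlt
    linarith
  have hsum : 0 < ∑ a ∈ S m, D a := Finset.sum_pos hpos ⟨j, hjS m⟩
  let f : α → ℤ := fun a => if a ∈ S m then 1 else 0
  have hsum2 : ∑ a ∈ S m, D a = ∑ i, f (L i s) - ∑ i, f (L i t) := by
    rw [← sum_colCount_smul, ← sum_colCount_smul]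
    simp [f, hD, Finset.sum_sub_distrib, Finset.sum_ite_mem]
  have hle : ∑ i, f (L i s) ≤ ∑ i, f (L i t) := by
    apply Finset.sum_le_sum
    intro i _
    by_cases h : L i s ∈ S m
    · have h' : L i t ∈ S m := by
        rw [← hSm]
        simp only [S, mem_filter, mem_univ, true_and] at h ⊢
        have : D (L i s) ≤ D (L i t) + 2 := hstep i
        push_cast
        linarith
      simp [f, h, h']
    · simp only [f, h, if_false]
      split_ifs <;> norm_num
  linarith

open Finset in
/-- The rows of an array can be permuted so that all columns have nearly equal counts. -/
theorem exists_perm_colCount_sub_le {ι τ α : Type*} [Fintype ι] [Fintype τ] [Fintype α]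
    [DecidableEq α] (L : ι → τ → α) :
    ∃ σ : ι → Equiv.Perm τ, ∀ s t j,
      colCount (fun i u => L i (σ i u)) s j - colCount (fun i u => L i (σ i u)) t j ≤
        2 * Fintype.card α := by
  classical
  obtain ⟨σ, -, hσ⟩ := Finset.exists_min_image (univ : Finset (ι → Equiv.Perm τ))
    (fun σ => ∑ u, ∑ j, colCount (fun i u => L i (σ i u)) u j ^ 2) univ_nonempty
  refine ⟨σ, fun s t j => ?_⟩
  rcases eq_or_ne s t with rfl | hst
  · simp
  refine colCount_sub_le _ s t (fun i => colCount_le_of_energy_le _ i hst ?_) j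
  have hupdate : Function.update (fun i u => L i (σ i u)) i ((fun u => L i (σ i u)) ∘
      Equiv.swap s t) = fun i' u => L i' (Function.update σ i (σ i * Equiv.swap s t) i' u) := by
    funext i' u
    rcases eq_or_ne i' i with rfl | h
    · simp
    · simp [h]
  rw [hupdate]
  exact hσ _ (mem_univ _)

open Finset in
/-- Zero-sum families over a finite set contain a nonempty zero-sum subfamily of bounded size. -/
theorem exists_bound_zero_sum_subfamily {M : Type*} [AddCommGroup M] (B : Finset M) :
    ∃ N : ℕ, ∀ (τ : Type) [Fintype τ] [Nonempty τ] (f : τ → M), (∀ t, f t ∈ B) →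
      ∑ t, f t = 0 → ∃ T : Finset τ, T.Nonempty ∧ #T ≤ N ∧ ∑ t ∈ T, f t = 0 := by
  classical
  let Z : Set (B → ℕ) := {m | m ≠ 0 ∧ ∑ b, m b • (b : M) = 0}
  have hfin : {m | Minimal (· ∈ Z) m}.Finite :=
    WellQuasiOrderedLE.finite_of_isAntichain (setOfPred_minimal_antichain _)
  obtain ⟨N, hN⟩ := (hfin.image fun m => ∑ b, m b).bddAbove
  refine ⟨N, fun τ _ _ f hf hsum => ?_⟩
  let c : B → Finset τ := fun b => univ.filter fun t => f t = b
  have hc : (fun b => #(c b)) ∈ Z := by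
    refine ⟨fun h => ?_, ?_⟩
    · obtain ⟨t⟩ := ‹Nonempty τ›
      have := congrFun h ⟨f t, hf t⟩
      simp only [c, Pi.zero_apply, card_eq_zero] at this
      exact (Finset.eq_empty_iff_forall_notMem.1 this t) (by simp)
    · rw [← hsum, ← Finset.sum_fiberwise univ (fun t => (⟨f t, hf t⟩ : B)) f]
      refine Finset.sum_congr rfl fun b _ => ?_
      rw [← Finset.sum_const]
      refine Finset.sum_congr ?_ ?_
      · ext t
        simp [c, Subtype.ext_iff]
      · intro t ht
        simp only [mem_filter] at ht
        rw [← ht.2]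
  obtain ⟨m, hmle, hm⟩ := exists_minimal_le_of_wellFoundedLT (· ∈ Z) _ hc
  choose T hTsub hTcard using fun b => Finset.exists_subset_card_eq (hmle b)
  have hdisj : ((univ : Finset B) : Set B).PairwiseDisjoint T := by
    intro b _ b' _ hbb'
    refine Finset.disjoint_left.2 fun t ht ht' => hbb' (Subtype.ext ?_)
    have h1 := hTsub b ht
    have h2 := hTsub b' ht'
    simp only [c, mem_filter, mem_univ, true_and] at h1 h2
    rw [← h1, h2]
  have hcard : #(univ.biUnion T) = ∑ b, m b := by
    rw [Finset.card_biUnion hdisj]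
    exact Finset.sum_congr rfl fun b _ => hTcard b
  refine ⟨univ.biUnion T, ?_, ?_, ?_⟩
  · rw [← Finset.card_pos, hcard]
    obtain ⟨b, hb⟩ := Function.ne_iff.1 hm.prop.1
    exact Finset.sum_pos' (fun _ _ => Nat.zero_le _) ⟨b, mem_univ _, Nat.pos_of_ne_zero hb⟩
  · rw [hcard]
    exact hN ⟨m, hm, rfl⟩
  · rw [Finset.sum_biUnion hdisj, ← hm.prop.2]
    refine Finset.sum_congr rfl fun b _ => ?_
    rw [← hTcard b, ← Finset.sum_const]
    refine Finset.sum_congr rfl fun t ht => ?_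
    have h1 := hTsub b ht
    simpa [c] using h1

/-- Vectors `f i` of a fixed size `d` are the count vectors of the rows of an array of width `d`. -/
theorem exists_array_of_sum_eq {ι α : Type*} [Fintype α] [DecidableEq α] (d : ℕ)
    (f : ι → α → ℕ) (hf : ∀ i, ∑ j, f i j = d) :
    ∃ L : ι → Fin d → α, ∀ i j, (Finset.univ.filter fun t => L i t = j).card = f i j := by
  let φ : ∀ i, (Σ j, Fin (f i j)) ≃ Fin d := fun i => Fintype.equivFinOfCardEq (by simp [hf i])
  refine ⟨fun i t => ((φ i).symm t).1, fun i j => ?_⟩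
  rw [← Fintype.card_subtype,
    Fintype.card_congr (((φ i).symm.subtypeEquiv fun _ => Iff.rfl).trans
      (Equiv.sigmaSubtype j))]
  simp

open Finset in
/-- An invariant multi-homogeneous exponent of positive degree has a nonzero invariant
multi-homogeneous part of bounded degree. -/
theorem exists_bound_invariant_part (r k : ℕ) (w : Fin k → Fin r → ℤ) :
    ∃ N : ℕ, ∀ (n d : ℕ) (e : Fin n × Fin k →₀ ℕ), 0 < d → InvariantMon r n k w e →
      MultiHomog n k d e → ∃ (d' : ℕ) (e' : Fin n × Fin k →₀ ℕ), 0 < d' ∧ d' ≤ N ∧ e' ≤ e ∧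
        InvariantMon r n k w e' ∧ MultiHomog n k d' e' := by
  let C : Fin r → ℤ := fun l => ∑ j, 2 * k * |w j l|
  obtain ⟨N, hN⟩ := exists_bound_zero_sum_subfamily (Finset.Icc (-C) C)
  refine ⟨N, fun n d e hd hinv hhom => ?_⟩
  obtain ⟨L₀, hL₀⟩ := exists_array_of_sum_eq d (fun i j => e (i, j)) hhom
  obtain ⟨σ, hσ⟩ := exists_perm_colCount_sub_le L₀
  let L : Fin n → Fin d → Fin k := fun i u => L₀ i (σ i u)
  have hL : ∀ i j, #{t | L i t = j} = e (i, j) := by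
    intro i j
    rw [← hL₀]
    exact Finset.card_equiv (σ i) (by simp [L])
  have hweight : ∀ T : Finset (Fin d), ∑ i, ∑ j, ((#{t ∈ T | L i t = j} : ℕ) : ℤ) • w j =
      ∑ t ∈ T, ∑ i, w (L i t) := by
    intro T
    rw [Finset.sum_comm (s := T)]
    refine Finset.sum_congr rfl fun i _ => ?_
    rw [← Finset.sum_fiberwise T (L i)]
    refine Finset.sum_congr rfl fun j _ => ?_
    rw [natCast_zsmul, ← Finset.sum_const]
    refine Finset.sum_congr rfl fun t ht => ?_
    rw [(mem_filter.1 ht).2]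
  have hzero : ∑ t, ∑ i, w (L i t) = 0 := by
    rw [← hweight, ← hinv]
    simp only [hL]
  have hdiff : ∀ s t l, (∑ i, w (L i s)) l - (∑ i, w (L i t)) l ≤ C l := by
    intro s t l
    rw [← sum_colCount_smul, ← sum_colCount_smul]
    simp only [Finset.sum_apply, Pi.smul_apply, smul_eq_mul, ← Finset.sum_sub_distrib, C,
      ← sub_mul]
    refine Finset.sum_le_sum fun j _ => (le_abs_self _).trans ?_
    rw [abs_mul]
    refine mul_le_mul_of_nonneg_right ?_ (abs_nonneg _)
    have h1 := hσ s t j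
    have h2 := hσ t s j
    rw [Fintype.card_fin] at h1 h2
    exact abs_le.2 ⟨by linarith, h1⟩
  have hd' : (0 : ℤ) < d := by exact_mod_cast hd
  have hzero' : ∀ l, ∑ t, (∑ i, w (L i t)) l = 0 := by
    intro l
    rw [← Finset.sum_apply, hzero, Pi.zero_apply]
  have hmem : ∀ t, ∑ i, w (L i t) ∈ Finset.Icc (-C) C := by
    intro t
    rw [Finset.mem_Icc]
    refine ⟨fun l => ?_, fun l => ?_⟩
    · have := Finset.sum_le_sum fun s (_ : s ∈ univ) => hdiff s t l
      simp only [Finset.sum_sub_distrib, hzero', sum_const, card_univ, Fintype.card_fin,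
        nsmul_eq_mul] at this
      simp only [Pi.neg_apply]
      nlinarith
    · have := Finset.sum_le_sum fun s (_ : s ∈ univ) => hdiff t s l
      simp only [Finset.sum_sub_distrib, hzero', sum_const, card_univ, Fintype.card_fin,
        nsmul_eq_mul] at this
      nlinarith
  have : Nonempty (Fin d) := ⟨⟨0, hd⟩⟩
  obtain ⟨T, hTne, hTcard, hTsum⟩ := hN (Fin d) _ hmem hzero
  refine ⟨#T, Finsupp.equivFunOnFinite.symm fun p => #{t ∈ T | L p.1 t = p.2},
    hTne.card_pos, hTcard, ?_, ?_, ?_⟩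
  · rintro ⟨i, j⟩
    rw [← hL]
    exact Finset.card_le_card (Finset.filter_subset_filter _ (Finset.subset_univ _))
  · rw [InvariantMon, ← hTsum, ← hweight]
    rfl
  · intro i
    exact (Finset.card_eq_sum_card_fiberwise (s := T) (f := L i) (t := univ)
      fun _ _ => Finset.mem_coe.2 (mem_univ _)).symm

theorem InvariantMon.tsub {r n k : ℕ} {w : Fin k → Fin r → ℤ} {e e' : Fin n × Fin k →₀ ℕ}
    (he : InvariantMon r n k w e) (he' : InvariantMon r n k w e') (hle : e' ≤ e) :
    InvariantMon r n k w (e - e') := by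
  obtain ⟨f, rfl⟩ := exists_add_of_le hle
  simp only [InvariantMon, Finsupp.add_apply, Nat.cast_add, add_smul, Finset.sum_add_distrib]
    at he he'
  rw [he', zero_add] at he
  rwa [add_tsub_cancel_left]

theorem MultiHomog.tsub {n k d d' : ℕ} {e e' : Fin n × Fin k →₀ ℕ}
    (he : MultiHomog n k d e) (he' : MultiHomog n k d' e') (hle : e' ≤ e) :
    MultiHomog n k (d - d') (e - e') := by
  obtain ⟨f, rfl⟩ := exists_add_of_le hle
  intro i
  rw [add_tsub_cancel_left, ← he i, ← he' i]
  simp only [Finsupp.add_apply, Finset.sum_add_distrib, add_tsub_cancel_left]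

/-- There is a `d₀`, independent of `n`, such that for all `n ≥ 1`
the invariant ring `R_n` is generated as a `ℂ`-algebra by the invariant
multi-homogeneous monomials of degree at most `d₀`. -/
theorem invariant_ring_generated_in_bounded_degree
    (r k : ℕ) (hr : 0 < r) (hk : 0 < k) (w : Fin k → Fin r → ℤ) :
    ∃ d₀ : ℕ, 0 < d₀ ∧
      ∀ n : ℕ, 0 < n →
        Algebra.adjoin ℂ (invMonomialsUpTo r n k w d₀) =
          Algebra.adjoin ℂ (invMonomials r n k w) := by
  obtain ⟨N, hN⟩ := exists_bound_invariant_part r k w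
  refine ⟨N + 1, N.succ_pos, fun n hn => le_antisymm (Algebra.adjoin_mono ?_)
    (Algebra.adjoin_le ?_)⟩
  · rintro p ⟨e, rfl, hinv, d, -, hhom⟩
    exact ⟨e, rfl, hinv, d, hhom⟩
  · rintro p ⟨e, rfl, hinv, d, hhom⟩
    induction d using Nat.strong_induction_on generalizing e with
    | _ d ih =>
      rcases Nat.eq_zero_or_pos d with rfl | hd
      · exact Algebra.subset_adjoin ⟨e, rfl, hinv, 0, Nat.zero_le _, hhom⟩
      · obtain ⟨d', e', hd'pos, hd'N, hle, hinv', hhom'⟩ := hN n d e hd hinv hhom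
        have hrest := ih (d - d') (by omega) (e - e') (hinv.tsub hinv' hle) (hhom.tsub hhom' hle)
        have hpart : monomial e' (1 : ℂ) ∈ Algebra.adjoin ℂ (invMonomialsUpTo r n k w (N + 1)) :=
          Algebra.subset_adjoin ⟨e', rfl, hinv', d', by omega, hhom'⟩
        have hmul := mul_mem hpart hrest
        rwa [monomial_mul, one_mul, add_tsub_cancel_of_le hle] at hmul
end

section
/- Let 𝒳 be a finite subset of ℤ^r. There exists a real number D > 0, depending only on 𝒳, such that for all positive integers n and d and every n × d zero-sum matrix A with entries in 𝒳, there exist permutations σ_1,…,σ_n of {1,…,d} such that the rearranged matrix B defined by B(i,j) = A(i, σ_i(j)) has all of its column sums of Euclidean norm at most D; that is, ‖Σ_{i=1}^n B(i,j)‖ ≤ D for every column index j. -/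
/-- The Euclidean norm of an integer vector `v ∈ ℤ^r`. -/
noncomputable def euclNorm {r : ℕ} (v : Fin r → ℤ) : ℝ :=
  Real.sqrt (∑ t, ((v t : ℝ)) ^ 2)

/-- Signs can be chosen for a finite family of vectors taken from a finite set `V` so that the
signed sum is bounded in terms of `V` alone. -/
theorem exists_subset_norm_sum_sub_two_nsmul_le {ι E : Type*} [SeminormedAddCommGroup E]
    (V : Finset E) (s : Finset ι) (v : ι → E) (hv : ∀ i ∈ s, v i ∈ V) :
    ∃ I ⊆ s, ‖∑ i ∈ s, v i - 2 • ∑ i ∈ I, v i‖ ≤ ∑ w ∈ V, ‖w‖ := by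
  classical
  have half (w : E) : ∃ T ⊆ s.filter (v · = w), T.card = (s.filter (v · = w)).card / 2 :=
    Finset.exists_subset_card_eq (Nat.div_le_self _ _)
  choose T hTs hT using half
  have mem_T {i : ι} {w : E} (hi : i ∈ T w) : i ∈ s ∧ v i = w := by
    simpa using hTs w hi
  refine ⟨s.filter fun i => i ∈ T (v i), Finset.filter_subset _ _, ?_⟩
  rw [← Finset.sum_fiberwise_of_maps_to hv v,
    ← Finset.sum_fiberwise_of_maps_to (t := V) (g := v)
      (fun i hi => hv i (Finset.mem_filter.1 hi).1) v,
    Finset.smul_sum, ← Finset.sum_sub_distrib]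
  refine norm_sum_le_of_le _ fun w _ => ?_
  have hfiber : {i ∈ {i ∈ s | i ∈ T (v i)} | v i = w} = T w := by
    ext i
    simp only [Finset.mem_filter]
    constructor
    · rintro ⟨⟨_, hi⟩, rfl⟩
      exact hi
    · intro hi
      obtain ⟨his, rfl⟩ := mem_T hi
      exact ⟨⟨his, hi⟩, rfl⟩
  rw [hfiber, Finset.sum_congr rfl fun i hi => (Finset.mem_filter.1 hi).2,
    Finset.sum_congr rfl fun i hi => (mem_T hi).2, Finset.sum_const, Finset.sum_const, hT,
    ← mul_nsmul']
  set m := (s.filter (v · = w)).card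
  have hm : m • w = (m % 2) • w + (2 * (m / 2)) • w := by
    rw [← add_nsmul, Nat.mod_add_div]
  rw [hm, add_sub_cancel_right]
  rcases Nat.mod_two_eq_zero_or_one m with h | h <;> simp [h]

/-- If moving `w` from `a` to `b` does not decrease the sum of squared norms, then it does not
decrease the norm of the difference. -/
theorem norm_sub_le_norm_sub_sub_two_nsmul {E : Type*} [NormedAddCommGroup E]
    [InnerProductSpace ℝ E] {a b w : E}
    (h : ‖a‖ ^ 2 + ‖b‖ ^ 2 ≤ ‖a - w‖ ^ 2 + ‖b + w‖ ^ 2) :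
    ‖a - b‖ ≤ ‖a - b - 2 • w‖ := by
  have h₁ := parallelogram_law_with_norm ℝ a b
  have h₂ := parallelogram_law_with_norm ℝ (a - w) (b + w)
  rw [show a - w + (b + w) = a + b by abel, show a - w - (b + w) = a - b - 2 • w by abel] at h₂
  exact le_of_sq_le_sq (by nlinarith) (norm_nonneg _)

open scoped Pointwise in
/-- The rows of a matrix with entries in a finite set `X` can be permuted separately so that any
two column sums differ by an amount bounded in terms of `X` alone. -/
theorem exists_perm_norm_sub_le {ι κ E : Type*} [Fintype ι] [Fintype κ]
    [NormedAddCommGroup E] [InnerProductSpace ℝ E] [DecidableEq E] (X : Finset E)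
    (A : ι → κ → E) (hA : ∀ i j, A i j ∈ X) :
    ∃ σ : ι → Equiv.Perm κ, ∀ j k,
      ‖∑ i, A i (σ i j) - ∑ i, A i (σ i k)‖ ≤ ∑ w ∈ X - X, ‖w‖ := by
  classical
  obtain ⟨σ, hσ⟩ := Finite.exists_min
    fun σ : ι → Equiv.Perm κ => ∑ j, ‖∑ i, A i (σ i j)‖ ^ 2
  refine ⟨σ, fun j k => ?_⟩
  obtain rfl | hjk := eq_or_ne j k
  · simpa using Finset.sum_nonneg fun w _ => norm_nonneg w
  obtain ⟨I, -, hI⟩ := exists_subset_norm_sum_sub_two_nsmul_le (X - X) Finset.univ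
    (fun i => A i (σ i j) - A i (σ i k)) fun i _ => Finset.sub_mem_sub (hA _ _) (hA _ _)
  rw [Finset.sum_sub_distrib] at hI
  refine (norm_sub_le_norm_sub_sub_two_nsmul ?_).trans hI
  let τ : ι → Equiv.Perm κ := fun i => if i ∈ I then σ i * Equiv.swap j k else σ i
  have hτj : ∑ i, A i (τ i j) = ∑ i, A i (σ i j) - ∑ i ∈ I, (A i (σ i j) - A i (σ i k)) := by
    rw [← Fintype.sum_ite_mem I, ← Finset.sum_sub_distrib]
    refine Finset.sum_congr rfl fun i _ => ?_
    by_cases hi : i ∈ I <;> simp [τ, hi]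
  have hτk : ∑ i, A i (τ i k) = ∑ i, A i (σ i k) + ∑ i ∈ I, (A i (σ i j) - A i (σ i k)) := by
    rw [← Fintype.sum_ite_mem I, ← Finset.sum_add_distrib]
    refine Finset.sum_congr rfl fun i _ => ?_
    by_cases hi : i ∈ I <;> simp [τ, hi]
  have hτ (l : κ) (hl : l ≠ j ∧ l ≠ k) : ∑ i, A i (τ i l) = ∑ i, A i (σ i l) := by
    refine Finset.sum_congr rfl fun i _ => ?_
    by_cases hi : i ∈ I <;> simp [τ, hi, Equiv.swap_apply_of_ne_of_ne hl.1 hl.2]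
  have hmin := sub_nonneg.2 (hσ τ)
  rw [← Finset.sum_sub_distrib,
    Fintype.sum_eq_add j k hjk fun l hl => by rw [hτ l hl, sub_self], hτj, hτk] at hmin
  linarith

/-- A finite family of vectors with zero sum and pairwise distances at most `K` consists of
vectors of norm at most `K`. -/
theorem norm_le_of_sum_eq_zero_of_norm_sub_le {κ E : Type*} [Fintype κ]
    [NormedAddCommGroup E] [NormedSpace ℝ E] {S : κ → E} {K : ℝ} (hS : ∑ k, S k = 0)
    (hK : ∀ j k, ‖S j - S k‖ ≤ K) (j : κ) : ‖S j‖ ≤ K := by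
  have : Nonempty κ := ⟨j⟩
  have hsum : ∑ k, (S j - S k) = Fintype.card κ • S j := by
    rw [Finset.sum_sub_distrib, hS, sub_zero, Finset.sum_const, Finset.card_univ]
  have hle : ‖∑ k, (S j - S k)‖ ≤ ∑ _k : κ, K := norm_sum_le_of_le _ fun k _ => hK j k
  rw [hsum, Finset.sum_const, Finset.card_univ, nsmul_eq_mul, ← Nat.cast_smul_eq_nsmul ℝ,
    norm_smul, Real.norm_natCast] at hle
  exact le_of_mul_le_mul_left hle (by exact_mod_cast Fintype.card_pos)

/-- The inclusion of `ℤ^r` into Euclidean space. -/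
noncomputable def intVecToEuclidean (r : ℕ) : (Fin r → ℤ) →+ EuclideanSpace ℝ (Fin r) where
  toFun v := WithLp.toLp 2 fun t => (v t : ℝ)
  map_zero' := by ext; simp
  map_add' v w := by ext; simp

theorem norm_intVecToEuclidean {r : ℕ} (v : Fin r → ℤ) :
    ‖intVecToEuclidean r v‖ = euclNorm v := by
  simp [EuclideanSpace.norm_eq, euclNorm, intVecToEuclidean]

/-- For a finite set `𝒳 ⊆ ℤ^r` there is a `D > 0` such that every
zero-sum matrix with entries in `𝒳` can be rearranged, permuting each row separately,
so that all column sums have Euclidean norm at most `D`. -/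
theorem zero_sum_matrix_rearrangement (r : ℕ) (𝒳 : Finset (Fin r → ℤ)) :
    ∃ D : ℝ, 0 < D ∧
      ∀ (n d : ℕ), 0 < n → 0 < d →
        ∀ A : Fin n → Fin d → (Fin r → ℤ),
          (∀ i j, A i j ∈ 𝒳) →
          (∑ i, ∑ j, A i j = 0) →
          ∃ σ : Fin n → Equiv.Perm (Fin d),
            ∀ j, euclNorm (∑ i, A i (σ i j)) ≤ D := by
  classical
  let f := intVecToEuclidean r
  let X := 𝒳.image f
  have hX : 0 ≤ ∑ w ∈ Finset.image₂ (· - ·) X X, ‖w‖ := Finset.sum_nonneg fun w _ => norm_nonneg w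
  refine ⟨∑ w ∈ Finset.image₂ (· - ·) X X, ‖w‖ + 1, by linarith, fun n d _ _ A hA hsum => ?_⟩
  obtain ⟨σ, hσ⟩ := exists_perm_norm_sub_le X (fun i j => f (A i j))
    fun i j => Finset.mem_image_of_mem f (hA i j)
  have hzero : ∑ j, ∑ i, f (A i (σ i j)) = 0 := by
    rw [Finset.sum_comm, Finset.sum_congr rfl fun i _ => Equiv.sum_comp (σ i) fun j => f (A i j)]
    simp only [← map_sum, hsum, map_zero]
  refine ⟨σ, fun j => ?_⟩
  rw [← norm_intVecToEuclidean, map_sum]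
  exact (norm_le_of_sum_eq_zero_of_norm_sub_le hzero hσ j).trans (le_add_of_nonneg_right zero_le_one)
end

section
/- Let m and L be positive integers and let a_1,…,a_L ∈ ℤ^m, and set Λ = {λ ∈ ℕ^L : Σ_{i=1}^L λ_i·a_i = 0}. Then there exists a positive integer d_0 such that every element λ ∈ Λ can be written as a finite sum λ = μ^{(1)} + ⋯ + μ^{(t)} of elements μ^{(s)} ∈ Λ each satisfying μ^{(s)}_1 + ⋯ + μ^{(s)}_L ≤ d_0. -/
/-- The submonoid of `ℕ^L` of coefficient vectors `c` with `Σ_i c_i • a_i = 0` is finitely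
generated. -/
theorem fg_mker_natCast_smul_sum {ι M : Type*} [Fintype ι] [AddCommGroup M] (a : ι → M) :
    ∃ S : Finset (ι → ℕ), ∀ c : ι → ℕ,
      c ∈ AddSubmonoid.closure (S : Set (ι → ℕ)) ↔ ∑ i, (c i : ℤ) • a i = 0 := by
  let f : (ι → ℕ) →+ M :=
    { toFun := fun c => ∑ i, (c i : ℤ) • a i
      map_zero' := by simp
      map_add' := fun c d => by simp [add_smul, Finset.sum_add_distrib] }
  obtain ⟨S, hS⟩ := AddSubmonoid.fg_eqLocusM f 0
  refine ⟨S, fun c => ?_⟩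
  rw [hS]
  rfl

/-- For vectors `a_1, …, a_L ∈ ℤ^m`, there is a positive integer `d₀`
such that every `λ ∈ ℕ^L` with `Σ_i λ_i • a_i = 0` is a finite sum of elements
`μ ∈ ℕ^L` with `Σ_i μ_i • a_i = 0` and `μ_1 + ⋯ + μ_L ≤ d₀`. -/
theorem lattice_kernel_generated_bounded (m L : ℕ) (hm : 0 < m) (hL : 0 < L)
    (a : Fin L → (Fin m → ℤ)) :
    ∃ d₀ : ℕ, 0 < d₀ ∧
      ∀ lam : Fin L → ℕ, (∑ i, (lam i : ℤ) • a i = 0) →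
        ∃ (t : ℕ) (μ : Fin t → (Fin L → ℕ)),
          (∀ s, ∑ i, (μ s i : ℤ) • a i = 0) ∧
          (∀ s, ∑ i, μ s i ≤ d₀) ∧
          lam = ∑ s, μ s := by
  obtain ⟨S, hS⟩ := fg_mker_natCast_smul_sum a
  refine ⟨S.sup (fun c => ∑ i, c i) + 1, Nat.succ_pos _, fun lam hlam => ?_⟩
  obtain ⟨l, hl, rfl⟩ := AddSubmonoid.exists_list_of_mem_closure ((hS lam).2 hlam)
  refine ⟨l.length, l.get, fun s => ?_, fun s => ?_, ?_⟩
  · exact (hS _).1 (AddSubmonoid.subset_closure (hl _ (l.get_mem s)))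
  · exact (Finset.le_sup (f := fun c : Fin L → ℕ => ∑ i, c i) (hl _ (l.get_mem s))).trans
      (Nat.le_succ _)
  · rw [← List.sum_ofFn, List.ofFn_get]
end

section
/- Let 𝒜 be a finite subset of ℤ^m. There exists a positive integer d, depending only on 𝒜, such that every nonempty finite multiset s of elements of 𝒜 whose sum is the zero vector admits a nonempty sub-multiset t ≤ s with card(t) ≤ d whose sum is also the zero vector. -/
/-- **Dickson's lemma** for multisets: the multisets supported on a finite set are partially
well-ordered by inclusion. -/
theorem Multiset.isPWO_setOf_forall_mem {α : Type*} (A : Finset α) :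
    {s : Multiset α | ∀ x ∈ s, x ∈ A}.IsPWO := by
  classical
  intro f
  obtain ⟨i, j, hij, h⟩ :=
    wellQuasiOrdered_le (fun n (a : A) => Multiset.count (a : α) (f n : Multiset α))
  refine ⟨i, j, hij, Multiset.le_iff_count.2 fun a => ?_⟩
  by_cases ha : a ∈ A
  · exact h ⟨a, ha⟩
  · rw [Multiset.count_eq_zero.2 fun hmem => ha ((f i).2 a hmem)]
    exact Nat.zero_le _

/-- For a finite set `𝒜 ⊆ ℤ^m` there is a positive integer `d` such
that every nonempty multiset of elements of `𝒜` with sum zero has a nonempty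
sub-multiset of cardinality at most `d` with sum zero. -/
theorem zero_sum_multiset_small_submultiset (m : ℕ) (𝒜 : Finset (Fin m → ℤ)) :
    ∃ d : ℕ, 0 < d ∧
      ∀ s : Multiset (Fin m → ℤ),
        (∀ x ∈ s, x ∈ 𝒜) → s ≠ 0 → s.sum = 0 →
        ∃ t : Multiset (Fin m → ℤ),
          t ≤ s ∧ t ≠ 0 ∧ Multiset.card t ≤ d ∧ t.sum = 0 := by
  by_contra! h
  choose s hs𝒜 hs0 hsum hs using fun n : ℕ => h (n + 1) n.succ_pos
  obtain ⟨g, hg⟩ :=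
    Set.isPWO_iff_exists_monotone_subseq.1 (Multiset.isPWO_setOf_forall_mem 𝒜) s hs𝒜
  set k := Multiset.card (s (g 0))
  have hk : k ≤ g k + 1 := (g.strictMono.le_apply).trans (Nat.le_succ _)
  exact hs (g k) (s (g 0)) (hg (Nat.zero_le k)) (hs0 _) hk (hsum _)
end

section
/- Let 𝒜 be a finite subset of ℤ^m. There exists a positive integer d, depending only on 𝒜, such that every finite multiset s of elements of 𝒜 whose sum is the zero vector can be written as a sum s = t_1 + ⋯ + t_N of nonempty multisets t_ℓ, each of cardinality at most d and each having sum equal to the zero vector. -/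
/-- The cardinalities of the minimal nonempty zero-sum multisets supported in a fixed finite set
are bounded. -/
theorem Multiset.exists_card_le_of_minimal_zero_sum {α : Type*} [AddCommMonoid α]
    (A : Finset α) :
    ∃ d : ℕ, ∀ t : Multiset α,
      Minimal (fun t ↦ (∀ x ∈ t, x ∈ A) ∧ t ≠ 0 ∧ t.sum = 0) t → card t ≤ d := by
  have hfin := (setOfPred_minimal_antichain
      (fun t : Multiset α ↦ (∀ x ∈ t, x ∈ A) ∧ t ≠ 0 ∧ t.sum = 0)).finite_of_partiallyWellOrderedOn
    ((isPWO_setOf_forall_mem A).mono fun _ ht ↦ (Set.mem_ofPred_eq ▸ ht).prop.1)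
  obtain ⟨d, hd⟩ := (hfin.image card).bddAbove
  exact ⟨d, fun t ht ↦ hd ⟨t, ht, rfl⟩⟩

/-- For a finite set `𝒜 ⊆ ℤ^m` there is a positive integer `d` such
that every multiset of elements of `𝒜` with sum zero decomposes as a sum of nonempty
multisets, each of cardinality at most `d` and each with sum zero. -/
theorem zero_sum_multiset_decomposition (m : ℕ) (𝒜 : Finset (Fin m → ℤ)) :
    ∃ d : ℕ, 0 < d ∧
      ∀ s : Multiset (Fin m → ℤ),
        (∀ x ∈ s, x ∈ 𝒜) → s.sum = 0 →
        ∃ (N : ℕ) (t : Fin N → Multiset (Fin m → ℤ)),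
          (∀ ℓ, t ℓ ≠ 0 ∧ Multiset.card (t ℓ) ≤ d ∧ (t ℓ).sum = 0) ∧
          s = ∑ ℓ, t ℓ := by
  obtain ⟨d, hd⟩ := Multiset.exists_card_le_of_minimal_zero_sum 𝒜
  refine ⟨d + 1, d.succ_pos, fun s ↦ ?_⟩
  induction s using WellFoundedLT.induction with
  | ind s ih =>
    intro hs hsum
    rcases eq_or_ne s 0 with rfl | hne
    · exact ⟨0, Fin.elim0, fun ℓ ↦ ℓ.elim0, by simp⟩
    obtain ⟨t, hts, ht⟩ := exists_minimal_le_of_wellFoundedLT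
      (fun t : Multiset (Fin m → ℤ) ↦ (∀ x ∈ t, x ∈ 𝒜) ∧ t ≠ 0 ∧ t.sum = 0) s ⟨hs, hne, hsum⟩
    obtain ⟨u, rfl⟩ := Multiset.le_iff_exists_add.1 hts
    obtain ⟨-, ht0, htsum⟩ := ht.prop
    have hlt : u < t + u := lt_add_of_pos_left u (pos_iff_ne_zero.2 ht0)
    obtain ⟨N, v, hv, rfl⟩ := ih u hlt (fun x hx ↦ hs x (Multiset.mem_add.2 (.inr hx)))
      (by simpa [htsum] using hsum)
    refine ⟨N + 1, Fin.cons t v, Fin.cases ⟨ht0, (hd t ht).trans d.le_succ, htsum⟩ hv, ?_⟩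
    rw [Fin.sum_univ_succ]
    simp
end

section
/- Let 𝒳 be a finite subset of ℤ^r and let C > 0 be a real number. There exists a positive integer d_0, depending only on 𝒳 and C, such that for all positive integers n and d ≥ 1 and every n × d zero-sum matrix A with entries in 𝒳 all of whose column sums have Euclidean norm at most C (i.e. ‖Σ_{i=1}^n A(i,j)‖ ≤ C for every j), there exists a nonempty set J ⊆ {1,…,d} of at most d_0 columns such that Σ_{i=1}^n Σ_{j∈J} A(i,j) = 0, i.e. the n × |J| submatrix of A on the columns in J is zero-sum. -/
/-- For a finite set `W` in an additive commutative monoid, there is a uniform bound on the size of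
a smallest nonempty zero-sum subfamily of a nonempty finite zero-sum family with values in `W`. -/
theorem exists_bound_card_zero_sum_subfamily {M : Type*} [AddCommMonoid M] (W : Finset M) :
    ∃ d₀ : ℕ, ∀ (ι : Type) [Fintype ι] [Nonempty ι] (f : ι → M), (∀ j, f j ∈ W) →
      ∑ j, f j = 0 → ∃ J : Finset ι, J.Nonempty ∧ J.card ≤ d₀ ∧ ∑ j ∈ J, f j = 0 := by
  classical
  let P : (W → ℕ) → Prop := fun m => m ≠ 0 ∧ ∑ w, m w • (w : M) = 0
  have hfin : {m | Minimal P m}.Finite :=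
    WellQuasiOrderedLE.finite_of_isAntichain (setOfPred_minimal_antichain P)
  refine ⟨hfin.toFinset.sup fun m => ∑ w, m w, fun ι _ _ f hf hsum => ?_⟩
  let g : ι → W := fun j => ⟨f j, hf j⟩
  let c : W → ℕ := fun w => (Finset.univ.filter fun j => g j = w).card
  have hc : P c := by
    refine ⟨fun h => ?_, ?_⟩
    · obtain ⟨j⟩ := ‹Nonempty ι›
      have h0 : c (g j) = 0 := congrFun h (g j)
      have hj : j ∈ Finset.univ.filter fun k => g k = g j := by simp
      rw [Finset.card_eq_zero.mp h0] at hj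
      simp at hj
    · rw [← hsum, ← Finset.sum_fiberwise Finset.univ g f]
      refine Finset.sum_congr rfl fun w _ => ?_
      refine (Finset.sum_eq_card_nsmul fun j hj => ?_).symm
      exact congrArg Subtype.val (Finset.mem_filter.mp hj).2
  obtain ⟨m, hmc, hm⟩ := exists_minimal_le_of_wellFoundedLT P c hc
  choose S hS hScard using fun w => Finset.exists_subset_card_eq (hmc w)
  have hSg : ∀ w, ∀ j ∈ S w, g j = w := fun w j hj => (Finset.mem_filter.mp (hS w hj)).2
  have hdisj : Set.PairwiseDisjoint ((Finset.univ : Finset W) : Set W) S := by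
    intro v _ w _ hvw
    refine Finset.disjoint_left.mpr fun j hv hw => hvw ?_
    rw [← hSg v j hv, hSg w j hw]
  have hcard : (Finset.univ.biUnion S).card = ∑ w, m w := by
    rw [Finset.card_biUnion hdisj]
    exact Finset.sum_congr rfl fun w _ => hScard w
  refine ⟨Finset.univ.biUnion S, ?_, ?_, ?_⟩
  · rw [← Finset.card_pos, hcard]
    refine Nat.pos_of_ne_zero fun h => hm.prop.1 ?_
    ext w
    exact Finset.sum_eq_zero_iff.mp h w (Finset.mem_univ w)
  · rw [hcard]
    exact Finset.le_sup (f := fun m : W → ℕ => ∑ w, m w) (hfin.mem_toFinset.mpr hm)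
  · rw [Finset.sum_biUnion hdisj, ← hm.prop.2]
    refine Finset.sum_congr rfl fun w _ => ?_
    rw [← hScard w]
    exact Finset.sum_eq_card_nsmul fun j hj => congrArg Subtype.val (hSg w j hj)

theorem abs_apply_le_euclNorm {r : ℕ} (v : Fin r → ℤ) (t : Fin r) :
    |(v t : ℝ)| ≤ euclNorm v :=
  Real.abs_le_sqrt
    (Finset.single_le_sum (f := fun s => (v s : ℝ) ^ 2) (fun _ _ => sq_nonneg _)
      (Finset.mem_univ t))

theorem finite_setOf_euclNorm_le (r : ℕ) (C : ℝ) :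
    {v : Fin r → ℤ | euclNorm v ≤ C}.Finite := by
  refine (Set.finite_Icc (fun _ : Fin r => -⌊C⌋) (fun _ => ⌊C⌋)).subset fun v hv => ?_
  have h : ∀ t, |v t| ≤ ⌊C⌋ := fun t => by
    refine Int.le_floor.mpr ?_
    push_cast
    exact (abs_apply_le_euclNorm v t).trans hv
  exact ⟨fun t => (abs_le.mp (h t)).1, fun t => (abs_le.mp (h t)).2⟩

/-- For a finite set `𝒳 ⊆ ℤ^r` and a real `C > 0` there is a positive
integer `d₀` such that every zero-sum matrix with entries in `𝒳` all of whose column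
sums have Euclidean norm at most `C` admits a nonempty set of at most `d₀` columns
forming a zero-sum submatrix. -/
theorem zero_sum_columns_extraction (r : ℕ) (𝒳 : Finset (Fin r → ℤ))
    (C : ℝ) (hC : 0 < C) :
    ∃ d₀ : ℕ, 0 < d₀ ∧
      ∀ (n d : ℕ), 0 < n → 1 ≤ d →
        ∀ A : Fin n → Fin d → (Fin r → ℤ),
          (∀ i j, A i j ∈ 𝒳) →
          (∑ i, ∑ j, A i j = 0) →
          (∀ j, euclNorm (∑ i, A i j) ≤ C) →
          ∃ J : Finset (Fin d),
            J.Nonempty ∧ J.card ≤ d₀ ∧ ∑ i, ∑ j ∈ J, A i j = 0 := by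
  obtain ⟨d₀, h⟩ := exists_bound_card_zero_sum_subfamily (finite_setOf_euclNorm_le r C).toFinset
  refine ⟨d₀ + 1, d₀.succ_pos, fun n d _ hd A _ hsum hA => ?_⟩
  have : Nonempty (Fin d) := ⟨⟨0, hd⟩⟩
  obtain ⟨J, hJ, hcard, hJsum⟩ := h (Fin d) (fun j => ∑ i, A i j)
    (fun j => (Set.Finite.mem_toFinset _).mpr (hA j)) (by rw [Finset.sum_comm]; exact hsum)
  exact ⟨J, hJ, hcard.trans d₀.le_succ, by rw [Finset.sum_comm]; exact hJsum⟩
end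

section
/- Let σ and τ be types and let φ : MvPolynomial σ ℂ → MvPolynomial τ ℂ be a ℂ-algebra homomorphism that sends each variable X_s (s ∈ σ) to a monic monomial of MvPolynomial τ ℂ (a finite product of variables with coefficient 1). Then the ideal ker φ is generated, as an ideal of MvPolynomial σ ℂ, by the binomials X^a − X^b, where X^a and X^b range over pairs of monic monomials of MvPolynomial σ ℂ satisfying φ(X^a) = φ(X^b). -/
open MvPolynomial

theorem MvPolynomial.exists_map_monomial_eq_monomial {R σ τ : Type*} [CommSemiring R]
    (φ : MvPolynomial σ R →ₐ[R] MvPolynomial τ R)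
    (hφ : ∀ s : σ, ∃ b : τ →₀ ℕ, φ (X s) = monomial b 1) (a : σ →₀ ℕ) :
    ∃ b : τ →₀ ℕ, φ (monomial a 1) = monomial b 1 := by
  induction a using Finsupp.induction_linear with
  | zero => exact ⟨0, map_one φ⟩
  | add a₁ a₂ h₁ h₂ =>
    obtain ⟨b₁, h₁⟩ := h₁
    obtain ⟨b₂, h₂⟩ := h₂
    refine ⟨b₁ + b₂, ?_⟩
    rw [← one_mul (1 : R), ← monomial_mul, map_mul, h₁, h₂, monomial_mul]
  | single s n =>
    obtain ⟨b, hb⟩ := hφ s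
    refine ⟨n • b, ?_⟩
    rw [← X_pow_eq_monomial, map_pow, hb, monomial_pow, one_pow]

/-- If `φ` maps monic monomials to monic monomials, then some linear map `L` is a section of `φ`
modulo the binomials in its kernel. -/
theorem MvPolynomial.exists_linearMap_sub_mem_span_binomials {R σ τ : Type*} [CommRing R]
    (φ : MvPolynomial σ R →ₐ[R] MvPolynomial τ R)
    (hφ : ∀ a : σ →₀ ℕ, ∃ b : τ →₀ ℕ, φ (monomial a 1) = monomial b 1) :
    ∃ L : MvPolynomial τ R →ₗ[R] MvPolynomial σ R, ∀ p, p - L (φ p) ∈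
      Ideal.span {p : MvPolynomial σ R |
        ∃ a b : σ →₀ ℕ, p = monomial a 1 - monomial b 1 ∧
          φ (monomial a 1) = φ (monomial b 1)} := by
  choose g hg using hφ
  let L := (basisMonomials τ R).constr R
    fun t ↦ (monomial (Function.invFun g t) 1 : MvPolynomial σ R)
  have hL (t : τ →₀ ℕ) : L (monomial t 1) = monomial (Function.invFun g t) 1 := by
    simpa using (basisMonomials τ R).constr_basis R
      (fun t ↦ (monomial (Function.invFun g t) 1 : MvPolynomial σ R)) t
  refine ⟨L, fun p ↦ ?_⟩
  induction p using MvPolynomial.induction_on' with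
  | monomial a c =>
    have hc : (monomial a c : MvPolynomial σ R) = c • monomial a 1 := by
      rw [smul_monomial, smul_eq_mul, mul_one]
    rw [hc, map_smul, map_smul, ← smul_sub, hg, hL]
    refine Submodule.smul_of_tower_mem _ c (Ideal.subset_span ⟨_, _, rfl, ?_⟩)
    rw [hg, hg, Function.invFun_eq (f := g) ⟨a, rfl⟩]
  | add p q hp hq =>
    rw [map_add, map_add, add_sub_add_comm]
    exact add_mem hp hq

/-- If a `ℂ`-algebra homomorphism `φ` between multivariate polynomial
rings sends each variable to a monic monomial, then `ker φ` is generated as an ideal by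
the binomials `X^a - X^b` with `φ(X^a) = φ(X^b)`. -/
theorem toric_ideal_generated_by_binomials {σ τ : Type*}
    (φ : MvPolynomial σ ℂ →ₐ[ℂ] MvPolynomial τ ℂ)
    (hφ : ∀ s : σ, ∃ b : τ →₀ ℕ, φ (X s) = monomial b 1) :
    RingHom.ker φ.toRingHom =
      Ideal.span {p : MvPolynomial σ ℂ |
        ∃ a b : σ →₀ ℕ, p = monomial a 1 - monomial b 1 ∧
          φ (monomial a 1) = φ (monomial b 1)} := by
  apply le_antisymm
  · intro p hp
    obtain ⟨L, hL⟩ := exists_linearMap_sub_mem_span_binomials φ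
      (exists_map_monomial_eq_monomial φ hφ)
    have hp : φ p = 0 := hp
    simpa only [hp, map_zero, sub_zero] using hL p
  · rw [Ideal.span_le]
    rintro _ ⟨a, b, rfl, h⟩
    change φ (monomial a 1 - monomial b 1) = 0
    rw [map_sub, h, sub_self]
end
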